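/- There is a universal constant c > 0 with the following property: for every n ≥ 2, if K ⊂ R^n is a Euclidean ball centered at the origin with Vol_n(K) = c n^2, then there exists a lattice L ⊂ R^n of covolume one such that L ∩ K = {0}. -/

import Mathlib

/- STATEMENT 1: There is a universal constant c > 0 with the following property: for every
n ≥ 2, if K ⊂ R^n is a Euclidean ball centered at the origin with Vol_n(K) = c n^2, then
there exists a lattice L ⊂ R^n of covolume one such that L ∩ K = {0}. -/

open MeasureTheory
noncomputable section

abbrev Euc (n : ℕ) := EuclideanSpace ℝ (Fin n)

/-- The integer lattice points `ℤ^n ⊂ ℝ^n`. -/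
def intPoints (n : ℕ) : Set (Euc n) := {x | ∀ i, ∃ m : ℤ, x i = (m : ℝ)}

open Filter Topology Matrix
open scoped Pointwise

/-- The standard Gaussian density on the line. -/
def gaussDensity (s : ℝ) : ℝ := (√(2 * Real.pi))⁻¹ * Real.exp (-(s ^ 2 / 2))

/-- The upper tail of the standard Gaussian measure. -/
def gaussTail (s : ℝ) : ℝ := ∫ z in Set.Ioi s, gaussDensity z

/-- The expectation of `(N - s)₊` for a standard Gaussian variable `N`. -/
def gaussCall (s : ℝ) : ℝ := gaussDensity s - s * gaussTail s

/-- The expectation of `(N - s)₊ ^ 2` for a standard Gaussian variable `N`. -/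
def gaussCallSq (s : ℝ) : ℝ := (1 + s ^ 2) * gaussTail s - s * gaussDensity s

lemma gaussDensity_pos (s : ℝ) : 0 < gaussDensity s := by
  unfold gaussDensity; positivity

lemma gaussDensity_neg (s : ℝ) : gaussDensity (-s) = gaussDensity s := by
  simp [gaussDensity]

lemma integrable_gaussDensity : Integrable gaussDensity := by
  have := (integrable_exp_neg_mul_sq (b := 1 / 2) (by norm_num)).const_mul (√(2 * Real.pi))⁻¹
  refine this.congr (ae_of_all _ fun x => ?_)
  simp only [gaussDensity]; congr 2; ring

lemma integral_gaussDensity : ∫ s, gaussDensity s = 1 := by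
  have h := integral_gaussian (1 / 2)
  have e : ∀ x : ℝ, gaussDensity x = (√(2 * Real.pi))⁻¹ * Real.exp (-(1 / 2) * x ^ 2) := by
    intro x; simp only [gaussDensity]; congr 2; ring
  simp_rw [e]
  rw [integral_const_mul, h]
  have : Real.pi / (1 / 2) = 2 * Real.pi := by ring
  rw [this]
  exact inv_mul_cancel₀ (by positivity)

lemma hasDerivAt_gaussDensity (s : ℝ) : HasDerivAt gaussDensity (-(s * gaussDensity s)) s := by
  have h : HasDerivAt (fun s : ℝ => -(s ^ 2 / 2)) (-s) s := by
    refine ((hasDerivAt_pow 2 s).div_const 2).neg.congr_deriv ?_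
    simp
  refine (h.exp.const_mul (√(2 * Real.pi))⁻¹).congr_deriv ?_
  simp only [gaussDensity]; ring

lemma continuous_gaussDensity : Continuous gaussDensity :=
  continuous_iff_continuousAt.2 fun s => (hasDerivAt_gaussDensity s).continuousAt

lemma hasDerivAt_gaussTail (s : ℝ) : HasDerivAt gaussTail (-gaussDensity s) s := by
  have e : gaussTail = fun s => gaussTail 0 - ∫ z in (0 : ℝ)..s, gaussDensity z := by
    funext t
    have := intervalIntegral.integral_Ioi_sub_Ioi' (a := 0) (b := t) (μ := volume)
      integrable_gaussDensity.integrableOn integrable_gaussDensity.integrableOn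
    simp only [gaussTail]; linarith
  rw [e]
  exact (intervalIntegral.integral_hasDerivAt_right
    (integrable_gaussDensity.intervalIntegrable)
    (continuous_gaussDensity.stronglyMeasurableAtFilter _ _)
    continuous_gaussDensity.continuousAt).const_sub _

lemma gaussTail_nonneg (s : ℝ) : 0 ≤ gaussTail s :=
  setIntegral_nonneg measurableSet_Ioi fun z _ => (gaussDensity_pos z).le

lemma gaussTail_le_one (s : ℝ) : gaussTail s ≤ 1 := by
  rw [← integral_gaussDensity]
  exact setIntegral_le_integral integrable_gaussDensity
    (ae_of_all _ fun z => (gaussDensity_pos z).le)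

lemma gaussTail_antitone : Antitone gaussTail := fun _ _ h =>
  setIntegral_mono_set integrable_gaussDensity.integrableOn
    (ae_of_all _ fun z => (gaussDensity_pos z).le) (Set.Ioi_subset_Ioi h).eventuallyLE

lemma gaussTail_zero : gaussTail 0 = 1 / 2 := by
  have h1 : ∫ z in Set.Iic (0 : ℝ), gaussDensity z = gaussTail 0 := by
    have := integral_comp_neg_Iic (0 : ℝ) gaussDensity
    simp only [gaussDensity_neg, neg_zero] at this
    exact this
  have h2 := intervalIntegral.integral_Iic_add_Ioi (b := (0 : ℝ)) (μ := volume)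
    integrable_gaussDensity.integrableOn integrable_gaussDensity.integrableOn
  rw [h1, integral_gaussDensity] at h2
  change gaussTail 0 + gaussTail 0 = 1 at h2
  linarith

lemma half_le_gaussTail {s : ℝ} (hs : s ≤ 0) : 1 / 2 ≤ gaussTail s :=
  gaussTail_zero ▸ gaussTail_antitone hs

lemma tendsto_exp_mul_gaussDensity (c : ℝ) :
    Tendsto (fun s => Real.exp (c * s) * gaussDensity s) atTop (𝓝 0) := by
  have e : (fun s => Real.exp (c * s) * gaussDensity s) =
      fun s => (√(2 * Real.pi))⁻¹ * Real.exp (-(s * (s / 2 - c))) := by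
    funext s
    simp only [gaussDensity]
    rw [mul_left_comm, ← Real.exp_add]; congr 2; ring
  rw [e, ← mul_zero (√(2 * Real.pi))⁻¹]
  refine Tendsto.const_mul _ (Real.tendsto_exp_neg_atTop_nhds_zero.comp ?_)
  exact tendsto_id.atTop_mul_atTop₀
    (tendsto_atTop_add_const_right _ (-c) (tendsto_id.atTop_div_const (by norm_num)))

lemma tendsto_mul_gaussDensity : Tendsto (fun s => s * gaussDensity s) atTop (𝓝 0) := by
  refine squeeze_zero' ?_ ?_ (tendsto_exp_mul_gaussDensity 1)
  · filter_upwards [eventually_ge_atTop 0] with s hs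
    exact mul_nonneg hs (gaussDensity_pos s).le
  · filter_upwards with s
    gcongr
    · exact (gaussDensity_pos s).le
    · linarith [Real.add_one_le_exp (1 * s)]

lemma tendsto_gaussDensity : Tendsto gaussDensity atTop (𝓝 0) := by
  simpa using tendsto_exp_mul_gaussDensity 0

lemma integral_mul_gaussDensity (s : ℝ) :
    IntegrableOn (fun z => z * gaussDensity z) (Set.Ioi s) ∧
    ∫ z in Set.Ioi s, z * gaussDensity z = gaussDensity s := by
  have hi : Integrable (fun z => z * gaussDensity z) := by
    have := (integrable_mul_exp_neg_mul_sq (b := 1 / 2) (by norm_num)).const_mul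
      (√(2 * Real.pi))⁻¹
    refine this.congr (ae_of_all _ fun x => ?_)
    simp only [gaussDensity]
    rw [mul_left_comm]; congr 3; ring
  refine ⟨hi.integrableOn, ?_⟩
  have := integral_Ioi_of_hasDerivAt_of_tendsto' (a := s) (f := fun z => -gaussDensity z)
    (f' := fun z => z * gaussDensity z) (m := 0)
    (fun z _ => (hasDerivAt_gaussDensity z).neg.congr_deriv (neg_neg _)) hi.integrableOn
    (by simpa using tendsto_gaussDensity.neg)
  simpa using this

lemma gaussCall_nonneg (s : ℝ) : 0 ≤ gaussCall s := by
  have h : gaussCall s = ∫ z in Set.Ioi s, (z - s) * gaussDensity z := by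
    simp_rw [sub_mul]
    rw [integral_sub (integral_mul_gaussDensity s).1
      (integrable_gaussDensity.integrableOn.const_mul s), (integral_mul_gaussDensity s).2,
      integral_const_mul]
    rfl
  rw [h]
  exact setIntegral_nonneg measurableSet_Ioi fun z hz =>
    mul_nonneg (sub_nonneg.2 (le_of_lt hz)) (gaussDensity_pos z).le

lemma gaussTail_le_gaussDensity {s : ℝ} (hs : 1 ≤ s) : gaussTail s ≤ gaussDensity s := by
  have := gaussCall_nonneg s
  unfold gaussCall at this
  nlinarith [gaussTail_nonneg s]

lemma gaussCall_le_gaussDensity {s : ℝ} (hs : 0 ≤ s) : gaussCall s ≤ gaussDensity s := by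
  unfold gaussCall
  nlinarith [gaussTail_nonneg s]

lemma hasDerivAt_gaussCall (s : ℝ) : HasDerivAt gaussCall (-gaussTail s) s := by
  refine ((hasDerivAt_gaussDensity s).sub
    ((hasDerivAt_id s).mul (hasDerivAt_gaussTail s))).congr_deriv ?_
  simp

lemma hasDerivAt_gaussCallSq (s : ℝ) : HasDerivAt gaussCallSq (-2 * gaussCall s) s := by
  refine ((((hasDerivAt_pow 2 s).const_add 1).mul (hasDerivAt_gaussTail s)).sub
    ((hasDerivAt_id s).mul (hasDerivAt_gaussDensity s))).congr_deriv ?_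
  simp [gaussCall]; ring

lemma tendsto_gaussTail : Tendsto gaussTail atTop (𝓝 0) := by
  refine squeeze_zero' (Eventually.of_forall gaussTail_nonneg) ?_ tendsto_gaussDensity
  filter_upwards [eventually_ge_atTop 1] with s hs using gaussTail_le_gaussDensity hs

lemma gaussCallSq_antitone : Antitone gaussCallSq :=
  antitone_of_hasDerivAt_nonpos hasDerivAt_gaussCallSq fun s => by
    have := gaussCall_nonneg s
    simp only [Pi.zero_apply]; linarith

lemma tendsto_gaussCallSq : Tendsto gaussCallSq atTop (𝓝 0) := by
  have h1 : Tendsto (fun s => 2 * (s * gaussDensity s)) atTop (𝓝 0) := by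
    simpa using tendsto_mul_gaussDensity.const_mul 2
  have h2 : Tendsto (fun s => -(s * gaussDensity s)) atTop (𝓝 0) := by
    simpa using tendsto_mul_gaussDensity.neg
  refine tendsto_of_tendsto_of_tendsto_of_le_of_le' h2 h1 ?_ ?_
  · filter_upwards with s
    unfold gaussCallSq
    nlinarith [gaussTail_nonneg s, mul_nonneg (sq_nonneg s) (gaussTail_nonneg s)]
  · filter_upwards [eventually_ge_atTop 1] with s hs
    have h := gaussCall_nonneg s
    have h3 := gaussTail_le_gaussDensity hs
    have h4 := gaussDensity_pos s
    unfold gaussCall at h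
    unfold gaussCallSq
    nlinarith [mul_nonneg (by linarith : (0:ℝ) ≤ s) h]

lemma gaussCallSq_nonneg (s : ℝ) : 0 ≤ gaussCallSq s :=
  gaussCallSq_antitone.le_of_tendsto tendsto_gaussCallSq s

/-- If a finite family of nonnegative reals has at most `K * exp (l * w)` members below every
`w > 0`, then the sum over the family of a decreasing function is bounded by the corresponding
integral. -/
lemma sum_le_of_card_le {ι : Type*} (S : Finset ι) (y : ι → ℝ) (hy : ∀ s ∈ S, 0 ≤ y s)
    {K l : ℝ} (hcard : ∀ w, 0 < w → ((S.filter fun s => y s < w).card : ℝ) ≤ K * Real.exp (l * w))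
    {W g H : ℝ → ℝ} (hg : ∀ w, 0 ≤ g w) (hW : ∀ w, HasDerivAt W (-g w) w)
    (hW0 : Tendsto W atTop (𝓝 0)) (hH : ∀ w, HasDerivAt H (-(g w * Real.exp (l * w))) w)
    (hH0 : Tendsto H atTop (𝓝 0)) : ∑ s ∈ S, W (y s) ≤ K * H 0 := by
  have hWi : ∀ a, IntegrableOn g (Set.Ioi a) := fun a => by
    have := (integrableOn_Ioi_deriv_of_nonpos' (a := a) (fun x _ => hW x)
      (fun x _ => neg_nonpos.2 (hg x)) hW0).neg
    simpa using this
  have hWe : ∀ a, W a = ∫ w in Set.Ioi a, g w := fun a => by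
    have := integral_Ioi_of_hasDerivAt_of_nonpos' (a := a) (fun x _ => hW x)
      (fun x _ => neg_nonpos.2 (hg x)) hW0
    rw [integral_neg] at this; linarith
  have hHi : IntegrableOn (fun w => g w * Real.exp (l * w)) (Set.Ioi 0) := by
    have := (integrableOn_Ioi_deriv_of_nonpos' (a := (0 : ℝ)) (fun x _ => hH x)
      (fun x _ => neg_nonpos.2 (mul_nonneg (hg x) (Real.exp_pos _).le)) hH0).neg
    simpa using this
  have hHe : H 0 = ∫ w in Set.Ioi 0, g w * Real.exp (l * w) := by
    have := integral_Ioi_of_hasDerivAt_of_nonpos' (a := (0 : ℝ)) (fun x _ => hH x)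
      (fun x _ => neg_nonpos.2 (mul_nonneg (hg x) (Real.exp_pos _).le)) hH0
    rw [integral_neg] at this; linarith
  have hWe' : ∀ s ∈ S, W (y s) = ∫ w in Set.Ioi 0, (Set.Ioi (y s)).indicator g w := by
    intro s hs
    rw [hWe, setIntegral_indicator measurableSet_Ioi, Set.Ioi_inter_Ioi,
      sup_eq_right.2 (hy s hs)]
  rw [Finset.sum_congr rfl hWe', ← integral_finsetSum, hHe, ← integral_const_mul]
  · refine setIntegral_mono_on ?_ (hHi.const_mul K) measurableSet_Ioi fun w hw => ?_
    · exact integrable_finsetSum _ fun s _ => (hWi 0).indicator measurableSet_Ioi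
    · have : ∑ s ∈ S, (Set.Ioi (y s)).indicator g w
          = ((S.filter fun s => y s < w).card : ℝ) * g w := by
        simp only [Set.indicator_apply, Set.mem_Ioi]
        rw [← Finset.sum_filter, Finset.sum_const, nsmul_eq_mul]
      rw [this]
      nlinarith [hcard w hw, hg w]
  · exact fun s _ => (hWi 0).indicator measurableSet_Ioi

/-- The value `E[((√τ N + τ / 2 - y)₊) ^ 2]` for a standard Gaussian variable `N`. -/
def barrier (y τ : ℝ) : ℝ := τ * gaussCallSq ((y - τ / 2) / √τ)

/-- The derivative of `barrier y τ` in `τ`. -/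
def barrierRate (y τ : ℝ) : ℝ :=
  gaussTail ((y - τ / 2) / √τ) + √τ * gaussCall ((y - τ / 2) / √τ)

/-- Minus the derivative of `barrier y τ` in `y`. -/
def barrierSlope (y τ : ℝ) : ℝ := 2 * √τ * gaussCall ((y - τ / 2) / √τ)

lemma barrier_nonneg {τ : ℝ} (hτ : 0 ≤ τ) (y : ℝ) : 0 ≤ barrier y τ :=
  mul_nonneg hτ (gaussCallSq_nonneg _)

lemma barrierRate_nonneg (y τ : ℝ) : 0 ≤ barrierRate y τ :=
  add_nonneg (gaussTail_nonneg _) (mul_nonneg (Real.sqrt_nonneg _) (gaussCall_nonneg _))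

lemma barrierSlope_nonneg (y τ : ℝ) : 0 ≤ barrierSlope y τ :=
  mul_nonneg (by positivity) (gaussCall_nonneg _)

lemma half_le_barrierRate_zero {τ : ℝ} (hτ : 0 < τ) : 1 / 2 ≤ barrierRate 0 τ := by
  have h : (0 - τ / 2) / √τ ≤ 0 := div_nonpos_of_nonpos_of_nonneg (by linarith) (by positivity)
  have := mul_nonneg (Real.sqrt_nonneg τ) (gaussCall_nonneg ((0 - τ / 2) / √τ))
  have := half_le_gaussTail h
  unfold barrierRate; linarith

lemma hasDerivAt_barrier {τ : ℝ} (hτ : 0 < τ) (y : ℝ) :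
    HasDerivAt (fun y => barrier y τ) (-barrierSlope y τ) y := by
  have hs : 0 < √τ := Real.sqrt_pos.2 hτ
  have hd : HasDerivAt (fun y : ℝ => (y - τ / 2) / √τ) (1 / √τ) y :=
    ((hasDerivAt_id y).sub_const _).div_const _
  refine (((hasDerivAt_gaussCallSq _).comp y hd).const_mul τ).congr_deriv ?_
  have h2 : τ = √τ * √τ := (Real.mul_self_sqrt hτ.le).symm
  unfold barrierSlope
  field_simp
  rw [Real.sq_sqrt hτ.le]

lemma hasDerivAt_barrierSlope {τ : ℝ} (hτ : 0 < τ) (y : ℝ) :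
    HasDerivAt (fun y => barrierSlope y τ) (-(2 * gaussTail ((y - τ / 2) / √τ))) y := by
  have hs : 0 < √τ := Real.sqrt_pos.2 hτ
  have hd : HasDerivAt (fun y : ℝ => (y - τ / 2) / √τ) (1 / √τ) y :=
    ((hasDerivAt_id y).sub_const _).div_const _
  refine (((hasDerivAt_gaussCall _).comp y hd).const_mul (2 * √τ)).congr_deriv ?_
  field_simp

lemma hasDerivAt_barrier_time {τ : ℝ} (hτ : 0 < τ) (y : ℝ) :
    HasDerivAt (fun τ => barrier y τ) (barrierRate y τ) τ := by
  have hs : 0 < √τ := Real.sqrt_pos.2 hτ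
  have hd : HasDerivAt (fun τ : ℝ => (y - τ / 2) / √τ)
      ((-(1 / 2) * √τ - (y - τ / 2) * (1 / (2 * √τ))) / √τ ^ 2) τ :=
    (((hasDerivAt_id τ).div_const 2).const_sub y).div (Real.hasDerivAt_sqrt hτ.ne') hs.ne'
  refine ((hasDerivAt_id τ).mul ((hasDerivAt_gaussCallSq _).comp τ hd)).congr_deriv ?_
  have h2 : τ = √τ ^ 2 := (Real.sq_sqrt hτ.le).symm
  simp only [id, one_mul, barrierRate, Function.comp_def]
  generalize √τ = r at *
  subst h2
  unfold gaussCallSq gaussCall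
  field_simp
  ring

lemma barrier_monotoneOn (y : ℝ) : MonotoneOn (fun τ => barrier y τ) (Set.Ioi 0) := by
  refine monotoneOn_of_hasDerivWithinAt_nonneg (f' := fun τ => barrierRate y τ) (convex_Ioi 0) ?_ ?_ ?_
  · exact fun τ hτ => (hasDerivAt_barrier_time hτ y).continuousAt.continuousWithinAt
  · intro τ hτ
    rw [interior_Ioi] at hτ
    exact (hasDerivAt_barrier_time hτ y).hasDerivWithinAt
  · exact fun τ _ => barrierRate_nonneg y τ

lemma hasDerivAt_barrier_log {τ q : ℝ} (hτ : 0 < τ) (hq : 0 < q) :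
    HasDerivAt (fun q => barrier (Real.log q) τ) (-barrierSlope (Real.log q) τ * q⁻¹) q :=
  (hasDerivAt_barrier hτ _).comp q (Real.hasDerivAt_log hq.ne')

lemma hasDerivAt_barrierSlope_log {τ q : ℝ} (hτ : 0 < τ) (hq : 0 < q) :
    HasDerivAt (fun q => -barrierSlope (Real.log q) τ * q⁻¹)
      (2 * barrierRate (Real.log q) τ / q ^ 2) q := by
  have h1 : HasDerivAt (fun q => -barrierSlope (Real.log q) τ) _ q :=
    ((hasDerivAt_barrierSlope hτ _).comp q (Real.hasDerivAt_log hq.ne')).neg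
  refine (h1.mul (hasDerivAt_inv hq.ne')).congr_deriv ?_
  unfold barrierSlope barrierRate
  field_simp

lemma exp_mul_gaussDensity {τ : ℝ} (hτ : 0 < τ) (l w : ℝ) :
    Real.exp (l * w) * gaussDensity ((w - τ / 2) / √τ) =
      Real.exp ((l ^ 2 + l) * τ / 2) * gaussDensity ((w - τ / 2) / √τ - l * √τ) := by
  have hs : 0 < √τ := Real.sqrt_pos.2 hτ
  have h2 : τ = √τ ^ 2 := (Real.sq_sqrt hτ.le).symm
  unfold gaussDensity
  rw [mul_left_comm, mul_left_comm (Real.exp ((l ^ 2 + l) * τ / 2)), ← Real.exp_add,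
    ← Real.exp_add]
  congr 2
  generalize √τ = r at *
  subst h2
  field_simp
  ring

lemma sum_barrier_le {ι : Type*} (S : Finset ι) (y : ι → ℝ) (hy : ∀ s ∈ S, 0 ≤ y s)
    {K l τ : ℝ} (hK : 0 ≤ K) (hl : 0 < l) (hτ : 0 < τ)
    (hcard : ∀ w, 0 < w → ((S.filter fun s => y s < w).card : ℝ) ≤ K * Real.exp (l * w)) :
    ∑ s ∈ S, barrier (y s) τ ≤ K * (2 / l ^ 2 * Real.exp ((l ^ 2 + l) * τ / 2)) := by
  have hs : 0 < √τ := Real.sqrt_pos.2 hτ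
  set H : ℝ → ℝ := fun w =>
    Real.exp (l * w) * (-barrierSlope w τ / l - 2 * gaussTail ((w - τ / 2) / √τ) / l ^ 2) +
    2 / l ^ 2 * Real.exp ((l ^ 2 + l) * τ / 2) * gaussTail ((w - τ / 2) / √τ - l * √τ) with hH
  have hd : ∀ w, HasDerivAt (fun y : ℝ => (y - τ / 2) / √τ) (1 / √τ) w := fun w =>
    ((hasDerivAt_id w).sub_const _).div_const _
  have hlim : Tendsto (fun y : ℝ => (y - τ / 2) / √τ) atTop atTop :=
    (tendsto_atTop_add_const_right _ (-(τ / 2)) tendsto_id).atTop_div_const hs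
  have hexp : Tendsto (fun w => Real.exp (l * w) * gaussDensity ((w - τ / 2) / √τ)) atTop (𝓝 0) := by
    have h1 := (tendsto_gaussDensity.comp
      (tendsto_atTop_add_const_right _ (-(l * √τ)) hlim)).const_mul
      (Real.exp ((l ^ 2 + l) * τ / 2))
    rw [mul_zero] at h1
    refine h1.congr fun w => ?_
    rw [exp_mul_gaussDensity hτ]; rfl
  have hT : Tendsto (fun w => Real.exp (l * w) * gaussTail ((w - τ / 2) / √τ)) atTop (𝓝 0) := by
    refine squeeze_zero' (Eventually.of_forall fun w => mul_nonneg (Real.exp_pos _).le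
      (gaussTail_nonneg _)) ?_ hexp
    filter_upwards [hlim.eventually_ge_atTop 1] with w hw
    exact mul_le_mul_of_nonneg_left (gaussTail_le_gaussDensity hw) (Real.exp_pos _).le
  have hC : Tendsto (fun w => Real.exp (l * w) * gaussCall ((w - τ / 2) / √τ)) atTop (𝓝 0) := by
    refine squeeze_zero' (Eventually.of_forall fun w => mul_nonneg (Real.exp_pos _).le
      (gaussCall_nonneg _)) ?_ hexp
    filter_upwards [hlim.eventually_ge_atTop 0] with w hw
    exact mul_le_mul_of_nonneg_left (gaussCall_le_gaussDensity hw) (Real.exp_pos _).le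
  have key := sum_le_of_card_le S y hy hcard (W := fun y => barrier y τ)
    (g := fun y => barrierSlope y τ) (H := H) (fun w => barrierSlope_nonneg w τ)
    (hasDerivAt_barrier hτ) ?_ ?_ ?_
  · refine key.trans (mul_le_mul_of_nonneg_left ?_ hK)
    have h1 : 0 ≤ barrierSlope 0 τ / l := div_nonneg (barrierSlope_nonneg 0 τ) hl.le
    have h2 : 0 ≤ 2 * gaussTail ((0 - τ / 2) / √τ) / l ^ 2 :=
      div_nonneg (mul_nonneg zero_le_two (gaussTail_nonneg _)) (by positivity)
    have h3 : 2 / l ^ 2 * Real.exp ((l ^ 2 + l) * τ / 2) *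
        gaussTail ((0 - τ / 2) / √τ - l * √τ) ≤ 2 / l ^ 2 * Real.exp ((l ^ 2 + l) * τ / 2) :=
      mul_le_of_le_one_right (by positivity) (gaussTail_le_one _)
    simp only [hH, mul_zero, Real.exp_zero, one_mul, neg_div]
    linarith
  · have := (tendsto_gaussCallSq.comp hlim).const_mul τ
    rw [mul_zero] at this
    exact this
  · intro w
    have h1 : HasDerivAt (fun w => gaussTail ((w - τ / 2) / √τ)) _ w :=
      (hasDerivAt_gaussTail _).comp w (hd w)
    have h2 : HasDerivAt (fun w => gaussTail ((w - τ / 2) / √τ - l * √τ)) _ w :=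
      (hasDerivAt_gaussTail _).comp w ((hd w).sub_const (l * √τ))
    have h3 : HasDerivAt (fun w => Real.exp (l * w)) (Real.exp (l * w) * (l * 1)) w :=
      ((hasDerivAt_id w).const_mul l).exp
    refine ((h3.mul (((hasDerivAt_barrierSlope hτ w).neg.div_const l).sub
      ((h1.const_mul 2).div_const (l ^ 2)))).add
      (h2.const_mul (2 / l ^ 2 * Real.exp ((l ^ 2 + l) * τ / 2)))).congr_deriv ?_
    have h4 := exp_mul_gaussDensity hτ l w
    simp only [Pi.neg_apply, Pi.sub_apply]
    have h5 : 2 / l ^ 2 * Real.exp ((l ^ 2 + l) * τ / 2) *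
        (-gaussDensity ((w - τ / 2) / √τ - l * √τ) * (1 / √τ)) =
        -(2 / l ^ 2 * (1 / √τ) * (Real.exp (l * w) * gaussDensity ((w - τ / 2) / √τ))) := by
      rw [h4]; ring
    rw [h5]
    field_simp
    ring
  · have h1 := (hC.const_mul (-(2 * √τ) / l)).add ((hT.const_mul (-2 / l ^ 2)).add
      ((tendsto_gaussTail.comp (tendsto_atTop_add_const_right _ (-(l * √τ)) hlim)).const_mul
        (2 / l ^ 2 * Real.exp ((l ^ 2 + l) * τ / 2))))
    simp only [mul_zero, add_zero] at h1
    refine h1.congr fun w => ?_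
    simp only [hH, barrierSlope, Function.comp_def, ← sub_eq_add_neg]
    ring

/-- The quadratic form of a real square matrix. -/
def quad {n : ℕ} (A : Matrix (Fin n) (Fin n) ℝ) (x : Fin n → ℝ) : ℝ := x ⬝ᵥ A *ᵥ x

lemma quad_eq_sum {n : ℕ} (A : Matrix (Fin n) (Fin n) ℝ) (x : Fin n → ℝ) :
    quad A x = ∑ p : Fin n × Fin n, A p.1 p.2 * (x p.1 * x p.2) := by
  rw [Fintype.sum_prod_type]
  simp only [quad, dotProduct, mulVec, Finset.mul_sum]
  refine Finset.sum_congr rfl fun i _ => Finset.sum_congr rfl fun j _ => ?_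
  ring

lemma continuous_quad {n : ℕ} :
    Continuous fun p : Matrix (Fin n) (Fin n) ℝ × (Fin n → ℝ) => quad p.1 p.2 := by
  simp only [quad_eq_sum]
  fun_prop

/-- Given finitely many vectors, there is a Frobenius-orthonormal family of symmetric matrices
whose quadratic forms vanish at these vectors, with at most one dimension lost for each vector. -/
lemma exists_orthonormal_symm (n : ℕ) (Y : Finset (Fin n → ℝ)) :
    ∃ (m : ℕ) (U : Fin m → Matrix (Fin n) (Fin n) ℝ),
      ((n : ℝ) * (n + 1) / 2 ≤ m + Y.card) ∧ (∀ i, (U i).IsSymm) ∧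
      (∀ i, ∑ p : Fin n × Fin n, U i p.1 p.2 ^ 2 = 1) ∧
      (∀ i, ∀ y ∈ Y, quad (U i) y = 0) ∧
      ∀ y : Fin n → ℝ, ∑ i, quad (U i) y ^ 2 ≤ (y ⬝ᵥ y) ^ 2 := by
  let E := EuclideanSpace ℝ (Fin n × Fin n)
  let mat : E → Matrix (Fin n) (Fin n) ℝ := fun u => Matrix.of fun i j => u (i, j)
  let sq : (Fin n → ℝ) → E := fun y => WithLp.toLp 2 fun p => y p.1 * y p.2
  have hquad : ∀ (u : E) (y : Fin n → ℝ), quad (mat u) y = inner ℝ u (sq y) := by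
    intro u y
    rw [quad_eq_sum, PiLp.inner_apply]
    refine Finset.sum_congr rfl fun p _ => ?_
    simp [mat, sq, mul_comm]
  let V : Submodule ℝ E :=
    { carrier := {u | (∀ i j, u (i, j) = u (j, i)) ∧ ∀ y ∈ Y, inner ℝ u (sq y) = 0}
      add_mem' := by
        rintro u v ⟨hu, hu'⟩ ⟨hv, hv'⟩
        refine ⟨fun i j => ?_, fun y hy => ?_⟩
        · change u (i, j) + v (i, j) = u (j, i) + v (j, i)
          rw [hu, hv]
        · rw [inner_add_left, hu' y hy, hv' y hy, add_zero]
      zero_mem' := ⟨fun _ _ => rfl, fun y _ => inner_zero_left _⟩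
      smul_mem' := by
        rintro c u ⟨hu, hu'⟩
        refine ⟨fun i j => ?_, fun y hy => ?_⟩
        · change c * u (i, j) = c * u (j, i)
          rw [hu]
        · rw [inner_smul_left, hu' y hy, mul_zero] }
  let emb : (Sym2 (Fin n) → ℝ) →ₗ[ℝ] E :=
    { toFun := fun f => WithLp.toLp 2 fun p => f s(p.1, p.2)
      map_add' := fun _ _ => rfl
      map_smul' := fun _ _ => rfl }
  have hemb : Function.Injective emb := by
    intro f g h
    funext s
    induction s with
    | _ i j => exact congrArg (fun u : E => u (i, j)) h
  let φ : (Sym2 (Fin n) → ℝ) →ₗ[ℝ] (Y → ℝ) :=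
    LinearMap.pi fun y => (innerₛₗ ℝ (sq y)).comp emb
  have hdim : Module.finrank ℝ (LinearMap.ker φ) ≤ Module.finrank ℝ V := by
    have h1 : Module.finrank ℝ ((LinearMap.ker φ).map emb) = Module.finrank ℝ (LinearMap.ker φ) :=
      (Submodule.equivMapOfInjective emb hemb _).symm.finrank_eq
    rw [← h1]
    refine Submodule.finrank_mono ?_
    rintro _ ⟨f, hf, rfl⟩
    refine ⟨fun i j => ?_, fun y hy => ?_⟩
    · change f s(i, j) = f s(j, i)
      rw [Sym2.eq_swap]
    · have := congrFun (LinearMap.mem_ker.1 hf) ⟨y, hy⟩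
      rw [real_inner_comm]
      exact this
  have hrn := LinearMap.finrank_range_add_finrank_ker φ
  have hr : Module.finrank ℝ (LinearMap.range φ) ≤ Y.card := by
    refine (Submodule.finrank_le _).trans ?_
    simp
  have hs : 2 * Module.finrank ℝ (Sym2 (Fin n) → ℝ) = n * (n + 1) := by
    rw [Module.finrank_fintype_fun_eq_card, Sym2.card, Fintype.card_fin, Nat.choose_two_right,
      Nat.mul_div_cancel' (Nat.even_mul_pred_self _).two_dvd]
    simp [mul_comm]
  let b := stdOrthonormalBasis ℝ V
  have hb : Orthonormal ℝ fun i => (b i : E) := b.orthonormal.comp_linearIsometry V.subtypeₗᵢ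
  refine ⟨_, fun i => mat (b i), ?_, ?_, ?_, ?_, ?_⟩
  · have : n * (n + 1) ≤ 2 * (Module.finrank ℝ V + Y.card) := by omega
    have : ((n * (n + 1) : ℕ) : ℝ) ≤ ((2 * (Module.finrank ℝ V + Y.card) : ℕ) : ℝ) := by
      exact_mod_cast this
    push_cast at this
    linarith
  · intro i
    ext j k
    exact (b i).2.1 k j
  · intro i
    have h := hb.1 i
    rw [EuclideanSpace.norm_eq, Real.sqrt_eq_one] at h
    simpa [mat] using h
  · intro i y hy
    rw [hquad]
    exact (b i).2.2 y hy
  · intro y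
    have h := hb.sum_inner_products_le (sq y) (s := Finset.univ)
    simp only [hquad]
    have h2 : ‖sq y‖ ^ 2 = (y ⬝ᵥ y) ^ 2 := by
      rw [EuclideanSpace.norm_sq_eq, Fintype.sum_prod_type, pow_two (y ⬝ᵥ y), dotProduct,
        Finset.sum_mul_sum]
      refine Finset.sum_congr rfl fun i _ => Finset.sum_congr rfl fun j _ => ?_
      simp only [sq, Real.norm_eq_abs, sq_abs]
      ring
    rw [← h2]
    refine le_trans (le_of_eq ?_) h
    simp

lemma nonneg_of_isLocalMin {f f' : ℝ → ℝ} {c : ℝ} (hf : ∀ᶠ x in 𝓝 0, HasDerivAt f (f' x) x)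
    (hf' : HasDerivAt f' c 0) (h0 : f' 0 = 0) (hmin : ∀ᶠ x in 𝓝 0, f 0 ≤ f x) : 0 ≤ c := by
  by_contra! hc
  have hd : deriv f =ᶠ[𝓝 0] f' := hf.mono fun x hx => hx.deriv
  have h1 : deriv (deriv f) 0 = c := by rw [hd.deriv_eq, hf'.deriv]
  have hmax : IsLocalMax f 0 := isLocalMax_of_deriv_deriv_neg (by rw [h1]; exact hc)
    (by rw [hd.eq_of_nhds, h0]) hf.self_of_nhds.continuousAt
  have hconst : f =ᶠ[𝓝 0] fun _ => f 0 := by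
    filter_upwards [hmax, hmin] with x h2 h3 using le_antisymm h2 h3
  have h4 : deriv (deriv f) 0 = 0 := by
    rw [hconst.deriv.deriv_eq]; simp
  linarith

lemma log_det_le_trace_sub {n : ℕ} {M : Matrix (Fin n) (Fin n) ℝ} (hM : M.PosDef) :
    Real.log M.det ≤ M.trace - n := by
  rw [hM.isHermitian.det_eq_prod_eigenvalues, hM.isHermitian.trace_eq_sum_eigenvalues]
  simp only [RCLike.ofReal_real_eq_id, id]
  rw [Real.log_prod fun i _ => (hM.eigenvalues_pos i).ne']
  calc ∑ i, Real.log (hM.isHermitian.eigenvalues i)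
      ≤ ∑ i, (hM.isHermitian.eigenvalues i - 1) :=
        Finset.sum_le_sum fun i _ => Real.log_le_sub_one_of_pos (hM.eigenvalues_pos i)
    _ = _ := by simp

lemma abs_quad_le {n : ℕ} {U : Matrix (Fin n) (Fin n) ℝ}
    (hU : ∑ p : Fin n × Fin n, U p.1 p.2 ^ 2 = 1) (y : Fin n → ℝ) : |quad U y| ≤ y ⬝ᵥ y := by
  have h0 : 0 ≤ y ⬝ᵥ y := Finset.sum_nonneg fun i _ => mul_self_nonneg _
  refine abs_le_of_sq_le_sq ?_ h0
  rw [quad_eq_sum]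
  refine (Finset.sum_mul_sq_le_sq_mul_sq _ _ _).trans (le_of_eq ?_)
  rw [hU, one_mul, Fintype.sum_prod_type, pow_two (y ⬝ᵥ y), dotProduct, Finset.sum_mul_sum]
  refine Finset.sum_congr rfl fun i _ => Finset.sum_congr rfl fun j _ => ?_
  ring

lemma posDef_iff_quad {n : ℕ} {A : Matrix (Fin n) (Fin n) ℝ} :
    A.PosDef ↔ A.IsSymm ∧ ∀ x, x ≠ 0 → 0 < quad A x := by
  rw [Matrix.posDef_iff_dotProduct_mulVec]
  simp [quad, Matrix.IsHermitian, Matrix.IsSymm]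

lemma dotProduct_self_pos {n : ℕ} {x : Fin n → ℝ} (hx : x ≠ 0) : 0 < x ⬝ᵥ x :=
  lt_of_le_of_ne (Finset.sum_nonneg fun i _ => mul_self_nonneg (x i))
    (Ne.symm (mt dotProduct_self_eq_zero.1 hx))

lemma posDef_one_add_smul {n : ℕ} {U : Matrix (Fin n) (Fin n) ℝ} (hs : U.IsSymm)
    (hU : ∑ p : Fin n × Fin n, U p.1 p.2 ^ 2 = 1) {e : ℝ} (he : |e| < 1) :
    (1 + e • U).PosDef := by
  refine posDef_iff_quad.2 ⟨?_, fun x hx => ?_⟩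
  · simp [Matrix.IsSymm, hs.eq]
  · have h0 := dotProduct_self_pos hx
    have h1 := abs_quad_le hU x
    have h2 : quad (1 + e • U) x = x ⬝ᵥ x + e * quad U x := by
      simp [quad, add_mulVec, smul_mulVec]
    have h3 : |e * quad U x| < x ⬝ᵥ x := by
      rw [abs_mul]
      nlinarith [abs_nonneg e, abs_nonneg (quad U x)]
    rw [h2]
    linarith [(abs_lt.1 h3).1]

lemma log_det_one_add_smul {n : ℕ} {U : Matrix (Fin n) (Fin n) ℝ} (hs : U.IsSymm)
    (hU : ∑ p : Fin n × Fin n, U p.1 p.2 ^ 2 = 1) {e : ℝ} (he : |e| < 1) :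
    Real.log (1 + e • U).det + Real.log (1 + (-e) • U).det ≤ -e ^ 2 := by
  have h1 := posDef_one_add_smul hs hU he
  have h2 := posDef_one_add_smul hs hU (e := -e) (by rwa [abs_neg])
  have hprod : (1 + e • U) * (1 + (-e) • U) = 1 - e ^ 2 • (U * U) := by
    simp only [mul_add, add_mul, one_mul, mul_one, Matrix.smul_mul, Matrix.mul_smul, smul_smul]
    rw [show -e * e = -(e ^ 2) by ring, neg_smul, neg_smul]
    abel
  have htr : (U * U).trace = 1 := by
    rw [← hU, Fintype.sum_prod_type]
    simp only [Matrix.trace, Matrix.diag, Matrix.mul_apply]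
    refine Finset.sum_congr rfl fun i _ => Finset.sum_congr rfl fun j _ => ?_
    rw [pow_two, hs.apply i j]
  rw [← Real.log_mul h1.det_pos.ne' h2.det_pos.ne', ← det_mul]
  have hpd : (1 - e ^ 2 • (U * U)).PosDef := by
    refine posDef_iff_quad.2 ⟨by simp [Matrix.IsSymm, hs.eq], fun x hx => ?_⟩
    have h0 := dotProduct_self_pos hx
    have h3 : (U *ᵥ x) ⬝ᵥ (U *ᵥ x) ≤ x ⬝ᵥ x := by
      calc (U *ᵥ x) ⬝ᵥ (U *ᵥ x) ≤ ∑ i : Fin n, (∑ j, U i j ^ 2) * (x ⬝ᵥ x) := by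
            refine Finset.sum_le_sum fun i _ => ?_
            rw [← pow_two]
            refine (Finset.sum_mul_sq_le_sq_mul_sq Finset.univ (U i) x).trans (le_of_eq ?_)
            simp [dotProduct, pow_two]
        _ = x ⬝ᵥ x := by
            rw [← Finset.sum_mul, ← Fintype.sum_prod_type', hU, one_mul]
    have h4 : quad (1 - e ^ 2 • (U * U)) x = x ⬝ᵥ x - e ^ 2 * ((U *ᵥ x) ⬝ᵥ (U *ᵥ x)) := by
      rw [quad, sub_mulVec, one_mulVec, smul_mulVec, dotProduct_sub, dotProduct_smul, smul_eq_mul,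
        ← mulVec_mulVec, dotProduct_mulVec, ← mulVec_transpose, hs.eq]
    have h5 : e ^ 2 < 1 := by rw [← sq_abs]; nlinarith [abs_nonneg e]
    rw [h4]
    nlinarith
  rw [hprod]
  refine (log_det_le_trace_sub hpd).trans (le_of_eq ?_)
  simp [htr]

/-- The functional minimized over quadratic forms `A`: logarithmic determinant, plus a barrier
pushing away the vectors in `X`, plus a confining trace term. -/
def energy {n : ℕ} (X : Finset (Fin n → ℝ)) (τ : ℝ) (A : Matrix (Fin n) (Fin n) ℝ) : ℝ :=
  Real.log A.det + ∑ x ∈ X, barrier (Real.log (quad A x)) τ + A.trace / n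

lemma exists_eq_transpose_mul_self {n : ℕ} {A : Matrix (Fin n) (Fin n) ℝ} (hA : A.PosDef) :
    ∃ B : Matrix (Fin n) (Fin n) ℝ, B.det ≠ 0 ∧ A = Bᵀ * B := by
  open scoped MatrixOrder in
  obtain ⟨B, hB⟩ := CStarAlgebra.nonneg_iff_eq_star_mul_self.mp hA.posSemidef.nonneg
  have hAB : A = Bᵀ * B := by
    rw [hB, star_eq_conjTranspose, conjTranspose_eq_transpose_of_trivial]
  refine ⟨B, fun h => hA.det_pos.ne' ?_, hAB⟩
  rw [hAB, det_mul, h, mul_zero]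

lemma quad_transpose_mul_mul {n : ℕ} (B M : Matrix (Fin n) (Fin n) ℝ) (x : Fin n → ℝ) :
    quad (Bᵀ * M * B) x = quad M (B *ᵥ x) := by
  rw [quad, quad, mul_assoc, ← mulVec_mulVec, dotProduct_mulVec, vecMul_transpose, mulVec_mulVec]

lemma quad_add {n : ℕ} (M N : Matrix (Fin n) (Fin n) ℝ) (x : Fin n → ℝ) :
    quad (M + N) x = quad M x + quad N x := by
  simp [quad, add_mulVec]

lemma quad_smul {n : ℕ} (c : ℝ) (M : Matrix (Fin n) (Fin n) ℝ) (x : Fin n → ℝ) :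
    quad (c • M) x = c * quad M x := by
  simp [quad, smul_mulVec]

lemma quad_one {n : ℕ} (x : Fin n → ℝ) : quad 1 x = x ⬝ᵥ x := by
  simp [quad]

lemma one_le_sum_of_isMin {n : ℕ} {B U : Matrix (Fin n) (Fin n) ℝ} (hB : B.det ≠ 0)
    (hs : U.IsSymm) (hU : ∑ p : Fin n × Fin n, U p.1 p.2 ^ 2 = 1) {Λ : Set (Fin n → ℝ)}
    (hfin : {x ∈ Λ | quad (Bᵀ * B) x ≤ 2}.Finite) (hfeas : ∀ x ∈ Λ, 1 ≤ quad (Bᵀ * B) x)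
    (hz : ∀ x ∈ Λ, quad (Bᵀ * B) x = 1 → quad U (B *ᵥ x) = 0)
    {X : Finset (Fin n → ℝ)} (hX : ∀ x ∈ X, x ∈ Λ) {τ : ℝ} (hτ : 0 < τ)
    (hmin : ∀ A : Matrix (Fin n) (Fin n) ℝ, A.PosDef → (∀ x ∈ Λ, 1 ≤ quad A x) →
      energy X τ (Bᵀ * B) ≤ energy X τ A) :
    1 ≤ ∑ x ∈ X, quad U (B *ᵥ x) ^ 2 *
      (2 * barrierRate (Real.log (quad (Bᵀ * B) x)) τ / quad (Bᵀ * B) x ^ 2) := by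
  set A := Bᵀ * B with hA
  let q : (Fin n → ℝ) → ℝ := fun x => quad A x
  let b : (Fin n → ℝ) → ℝ := fun x => quad U (B *ᵥ x)
  let P : ℝ → Matrix (Fin n) (Fin n) ℝ := fun e => Bᵀ * (1 + e • U) * B
  have hq1 : ∀ x, q x = (B *ᵥ x) ⬝ᵥ (B *ᵥ x) := by
    intro x
    have := quad_transpose_mul_mul B 1 x
    rwa [mul_one, quad_one] at this
  have hbq : ∀ x, |b x| ≤ q x := fun x => by
    rw [hq1]
    exact abs_quad_le hU _
  have hPq : ∀ e x, quad (P e) x = q x + e * b x := by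
    intro e x
    simp only [P, b, quad_transpose_mul_mul, quad_add, quad_smul, quad_one, hq1]
  have hinj : Function.Injective B.mulVec :=
    mulVec_injective_of_isUnit ((isUnit_iff_isUnit_det _).2 hB.isUnit)
  have hPpos : ∀ e : ℝ, |e| < 1 → (P e).PosDef := by
    intro e he
    have := (posDef_one_add_smul hs hU he).conjTranspose_mul_mul_same hinj
    rwa [conjTranspose_eq_transpose_of_trivial] at this
  have hPdet : ∀ e : ℝ, |e| < 1 →
      Real.log (P e).det = Real.log A.det + Real.log (1 + e • U).det := by
    intro e he
    have h1 := (posDef_one_add_smul hs hU he).det_pos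
    rw [← Real.log_mul _ h1.ne']
    · simp only [P, hA, det_mul]
      ring_nf
    · simp [hA, hB]
  have hPtr : ∀ e : ℝ, (P e).trace = A.trace + e * (Bᵀ * U * B).trace := by
    intro e
    simp [P, hA, mul_add, add_mul]
  have hPfeas : ∀ᶠ e in 𝓝 (0 : ℝ), ∀ x ∈ Λ, 1 ≤ q x + e * b x := by
    have h1 : ∀ᶠ e in 𝓝 (0 : ℝ), ∀ x ∈ {x ∈ Λ | q x ≤ 2}, 1 ≤ q x + e * b x := by
      refine (eventually_all_finite hfin).2 fun x hx => ?_
      rcases (hfeas x hx.1).eq_or_lt with h | h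
      · refine Eventually.of_forall fun e => ?_
        simp only [b, hz x hx.1 h.symm, mul_zero, add_zero]
        exact h.le
      · have hc : Tendsto (fun e : ℝ => q x + e * b x) (𝓝 0) (𝓝 (q x + 0 * b x)) :=
          Continuous.tendsto (by fun_prop) 0
        rw [zero_mul, add_zero] at hc
        filter_upwards [hc.eventually_const_lt h] with e he using he.le
    have h2 : ∀ᶠ e in 𝓝 (0 : ℝ), |e| < 1 / 2 :=
      (continuous_abs.tendsto' (0 : ℝ) 0 abs_zero).eventually_lt_const (by norm_num)
    filter_upwards [h1, h2] with e he1 he2 x hx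
    rcases le_or_gt (q x) 2 with h | h
    · exact he1 x ⟨hx, h⟩
    · have h3 : |e * b x| ≤ 1 / 2 * q x := by
        rw [abs_mul]
        exact mul_le_mul he2.le (hbq x) (abs_nonneg _) (by norm_num)
      linarith [(abs_le.1 h3).1]
  have hneg : Tendsto (fun e : ℝ => -e) (𝓝 0) (𝓝 0) := by
    simpa using (continuous_neg.tendsto (0 : ℝ))
  have hsmall : ∀ᶠ e in 𝓝 (0 : ℝ), |e| < 1 :=
    (continuous_abs.tendsto' (0 : ℝ) 0 abs_zero).eventually_lt_const (by norm_num)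
  let w : ℝ → ℝ := fun q => barrier (Real.log q) τ
  let w1 : ℝ → ℝ := fun q => -barrierSlope (Real.log q) τ * q⁻¹
  let w2 : ℝ → ℝ := fun q => 2 * barrierRate (Real.log q) τ / q ^ 2
  let f : ℝ → ℝ := fun e => ∑ x ∈ X, (w (q x + e * b x) + w (q x + -e * b x)) - e ^ 2
  let f1 : ℝ → ℝ := fun e =>
    ∑ x ∈ X, (w1 (q x + e * b x) * b x + w1 (q x + -e * b x) * -b x) - 2 * e
  have hlin : ∀ x e, HasDerivAt (fun e => q x + e * b x) (b x) e := fun x e => by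
    simpa using ((hasDerivAt_id e).mul_const (b x)).const_add (q x)
  have hlin' : ∀ x e, HasDerivAt (fun e => q x + -e * b x) (-b x) e := fun x e => by
    simpa using (((hasDerivAt_id e).neg).mul_const (b x)).const_add (q x)
  have hqpos : ∀ x ∈ X, 0 < q x := fun x hx => one_pos.trans_le (hfeas x (hX x hx))
  have hf : ∀ᶠ e in 𝓝 (0 : ℝ), HasDerivAt f (f1 e) e := by
    filter_upwards [hPfeas, hneg.eventually hPfeas] with e h1 h2
    refine HasDerivAt.sub (HasDerivAt.fun_sum fun x hx => HasDerivAt.add ?_ ?_) ?_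
    · exact HasDerivAt.comp (h₂ := w) e
        (hasDerivAt_barrier_log hτ (one_pos.trans_le (h1 x (hX x hx)))) (hlin x e)
    · exact HasDerivAt.comp (h₂ := w) e
        (hasDerivAt_barrier_log hτ (one_pos.trans_le (h2 x (hX x hx)))) (hlin' x e)
    · simpa using hasDerivAt_pow 2 e
  have hf1 : HasDerivAt f1 (∑ x ∈ X, (w2 (q x) * b x * b x + w2 (q x) * -b x * -b x) - 2) 0 := by
    refine HasDerivAt.sub (HasDerivAt.fun_sum fun x hx => HasDerivAt.add ?_ ?_) ?_
    · refine HasDerivAt.mul_const ?_ _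
      refine HasDerivAt.comp (h₂ := w1) 0 ?_ (hlin x 0)
      rw [zero_mul, add_zero]
      exact hasDerivAt_barrierSlope_log hτ (hqpos x hx)
    · refine HasDerivAt.mul_const ?_ _
      refine HasDerivAt.comp (h₂ := w1) 0 ?_ (hlin' x 0)
      rw [neg_zero, zero_mul, add_zero]
      exact hasDerivAt_barrierSlope_log hτ (hqpos x hx)
    · simpa using (hasDerivAt_id (0 : ℝ)).const_mul 2
  have hc := nonneg_of_isLocalMin hf hf1 (by simp [f1]) (by
    filter_upwards [hPfeas, hneg.eventually hPfeas, hsmall] with e h1 h2 h3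
    have h3' : |-e| < 1 := by rwa [abs_neg]
    have g1 := hmin (P e) (hPpos e h3) fun x hx => by rw [hPq]; exact h1 x hx
    have g2 := hmin (P (-e)) (hPpos _ h3') fun x hx => by rw [hPq]; exact h2 x hx
    have g3 := log_det_one_add_smul hs hU h3
    simp only [energy, hPdet e h3, hPdet _ h3', hPtr, hPq] at g1 g2
    simp only [f, w, zero_mul, neg_zero, add_zero, Finset.sum_add_distrib]
    simp only [q, add_div, neg_mul, neg_div] at g1 g2 ⊢
    linarith)
  have hsum : ∑ x ∈ X, (w2 (q x) * b x * b x + w2 (q x) * -b x * -b x)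
      = 2 * ∑ x ∈ X, b x ^ 2 * w2 (q x) := by
    rw [Finset.mul_sum]
    exact Finset.sum_congr rfl fun x _ => by ring
  rw [hsum] at hc
  change 1 ≤ ∑ x ∈ X, b x ^ 2 * w2 (q x)
  linarith

lemma card_le_sum_barrierRate {n : ℕ} {A : Matrix (Fin n) (Fin n) ℝ} (hA : A.PosDef)
    {Λ : Set (Fin n → ℝ)} (hfin : {x ∈ Λ | quad A x ≤ 2}.Finite)
    (hfeas : ∀ x ∈ Λ, 1 ≤ quad A x) {X : Finset (Fin n → ℝ)} (hX : ∀ x ∈ X, x ∈ Λ)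
    (hXf : ∀ x ∈ Λ, quad A x = 1 → x ∈ X) {τ : ℝ} (hτ : 0 < τ)
    (hmin : ∀ A' : Matrix (Fin n) (Fin n) ℝ, A'.PosDef → (∀ x ∈ Λ, 1 ≤ quad A' x) →
      energy X τ A ≤ energy X τ A') :
    (n : ℝ) * (n + 1) / 4 ≤ ∑ x ∈ X, barrierRate (Real.log (quad A x)) τ := by
  classical
  obtain ⟨B, hB, rfl⟩ := exists_eq_transpose_mul_self hA
  set q : (Fin n → ℝ) → ℝ := fun x => quad (Bᵀ * B) x with hq
  let rate : (Fin n → ℝ) → ℝ := fun x => barrierRate (Real.log (q x)) τ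
  let Z := X.filter fun x => q x = 1
  obtain ⟨m, U, hm, hs, hU, hz, hb⟩ := exists_orthonormal_symm n (Z.image fun x => B *ᵥ x)
  have hz' : ∀ i, ∀ x ∈ Λ, q x = 1 → quad (U i) (B *ᵥ x) = 0 := fun i x hx h =>
    hz i _ (Finset.mem_image_of_mem _ (Finset.mem_filter.2 ⟨hXf x hx h, h⟩))
  have hq1 : ∀ x, q x = (B *ᵥ x) ⬝ᵥ (B *ᵥ x) := by
    intro x
    have := quad_transpose_mul_mul B 1 x
    rwa [mul_one, quad_one] at this
  have hsum : (m : ℝ) ≤ ∑ x ∈ X, ∑ i, quad (U i) (B *ᵥ x) ^ 2 * (2 * rate x / q x ^ 2) := by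
    rw [Finset.sum_comm]
    calc (m : ℝ) = ∑ _i : Fin m, (1 : ℝ) := by simp
      _ ≤ _ := Finset.sum_le_sum fun i _ =>
        one_le_sum_of_isMin hB (hs i) (hU i) hfin hfeas (hz' i) hX hτ hmin
  have hcard : ((Z.image fun x => B *ᵥ x).card : ℝ) ≤ ∑ x ∈ X, if q x = 1 then 1 else 0 := by
    rw [← Finset.sum_filter, Finset.sum_const, nsmul_one]
    exact_mod_cast Finset.card_image_le
  have hterm : ∀ x ∈ X, (∑ i, quad (U i) (B *ᵥ x) ^ 2 * (2 * rate x / q x ^ 2)) +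
      (if q x = 1 then 1 else 0) ≤ 2 * rate x := by
    intro x hx
    have hqx : 1 ≤ q x := hfeas x (hX x hx)
    split_ifs with h
    · have h0 : 1 / 2 ≤ rate x := by
        simp only [rate, h, Real.log_one]
        exact half_le_barrierRate_zero hτ
      rw [Finset.sum_eq_zero fun i _ => by rw [hz' i x (hX x hx) h]; simp]
      linarith
    · rw [← Finset.sum_mul, add_zero]
      have h0 : 0 ≤ rate x := barrierRate_nonneg _ _
      have h1 := hb (B *ᵥ x)
      rw [← hq1] at h1
      calc _ ≤ q x ^ 2 * (2 * rate x / q x ^ 2) := by gcongr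
        _ = 2 * rate x := by field_simp
  have := Finset.sum_le_sum hterm
  rw [Finset.sum_add_distrib, ← Finset.mul_sum] at this
  change _ ≤ ∑ x ∈ X, rate x
  linarith

lemma le_of_forall_exists_gt {f : ℝ → ℝ} {a b K : ℝ} (hab : a ≤ b) (hK : 0 ≤ K)
    (h1 : ∀ s t, a ≤ s → s ≤ t → t ≤ b → f t - f s ≤ K * (t - s))
    (h2 : ∀ t, a ≤ t → t < b → ∀ η > 0, ∃ s, t < s ∧ s ≤ b ∧ f s ≤ f t + η * (s - t)) :
    f b ≤ f a := by
  have key : ∀ η > 0, f b ≤ f a + η * (b - a) := by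
    intro η hη
    let S : Set ℝ := {t | a ≤ t ∧ t ≤ b ∧ f t ≤ f a + η * (t - a)}
    have haS : a ∈ S := ⟨le_rfl, hab, by simp⟩
    have hbdd : BddAbove S := ⟨b, fun t ht => ht.2.1⟩
    have haσ : a ≤ sSup S := le_csSup hbdd haS
    have hσb : sSup S ≤ b := csSup_le ⟨a, haS⟩ fun t ht => ht.2.1
    have hσ : sSup S ∈ S := by
      refine ⟨haσ, hσb, le_of_forall_pos_le_add fun δ hδ => ?_⟩
      obtain ⟨t, ht, htσ⟩ := exists_lt_of_lt_csSup ⟨a, haS⟩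
        (sub_lt_self (sSup S) (show 0 < δ / (K + 1) by positivity))
      have ht' : t ≤ sSup S := le_csSup hbdd ht
      have g1 := h1 t _ ht.1 ht' hσb
      have g2 : η * (t - a) ≤ η * (sSup S - a) := by gcongr
      have g3 : K * (sSup S - t) ≤ δ := by
        calc K * (sSup S - t) ≤ (K + 1) * (δ / (K + 1)) := by
              refine mul_le_mul ?_ ?_ ?_ ?_ <;> linarith
          _ = δ := by field_simp
      linarith [ht.2.2]
    rcases hσb.eq_or_lt with h | h
    · rw [h] at hσ
      exact hσ.2.2
    · obtain ⟨s, hs, hsb, hfs⟩ := h2 _ haσ h η hη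
      have : s ∈ S := ⟨haσ.trans hs.le, hsb, by linarith [hσ.2.2]⟩
      exact absurd (le_csSup hbdd this) (not_le.2 hs)
  refine le_of_forall_pos_le_add fun δ hδ => ?_
  have h := key (δ / (b - a + 1)) (by have := sub_nonneg.2 hab; positivity)
  refine h.trans (add_le_add_right ?_ _)
  have := sub_nonneg.2 hab
  rw [div_mul_eq_mul_div, div_le_iff₀ (by positivity)]
  nlinarith

lemma abs_apply_le_trace {n : ℕ} {A : Matrix (Fin n) (Fin n) ℝ} (hA : A.PosSemidef) (i j : Fin n) :
    |A i j| ≤ A.trace := by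
  open scoped MatrixOrder in
  obtain ⟨B, rfl⟩ := CStarAlgebra.nonneg_iff_eq_star_mul_self.mp hA.nonneg
  have hcol : ∀ l, ∑ k, B k l ^ 2 ≤ (star B * B).trace := by
    intro l
    have : (star B * B).trace = ∑ l, ∑ k, B k l ^ 2 := by
      simp [Matrix.trace, Matrix.mul_apply, star_eq_conjTranspose, pow_two]
    rw [this]
    exact Finset.single_le_sum (f := fun l => ∑ k, B k l ^ 2)
      (fun l _ => Finset.sum_nonneg fun k _ => sq_nonneg _) (Finset.mem_univ l)
  have h1 : |(star B * B) i j| ≤ ∑ k, (B k i ^ 2 + B k j ^ 2) / 2 := by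
    rw [Matrix.mul_apply]
    refine (Finset.abs_sum_le_sum_abs _ _).trans (Finset.sum_le_sum fun k _ => ?_)
    rw [star_eq_conjTranspose, conjTranspose_eq_transpose_of_trivial, transpose_apply, abs_mul]
    nlinarith [sq_nonneg (|B k i| - |B k j|), sq_abs (B k i), sq_abs (B k j)]
  refine h1.trans ?_
  rw [← Finset.sum_div, Finset.sum_add_distrib]
  linarith [hcol i, hcol j]

lemma posSemidef_iff_quad {n : ℕ} {A : Matrix (Fin n) (Fin n) ℝ} :
    A.PosSemidef ↔ A.IsSymm ∧ ∀ x, 0 ≤ quad A x := by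
  rw [Matrix.posSemidef_iff_dotProduct_mulVec]
  simp [quad, Matrix.IsHermitian, Matrix.IsSymm]

lemma isClosed_one_le_quad {n : ℕ} (Λ : Set (Fin n → ℝ)) :
    IsClosed {A : Matrix (Fin n) (Fin n) ℝ | ∀ x ∈ Λ, 1 ≤ quad A x} := by
  simp only [Set.ofPred_forall]
  refine isClosed_biInter fun x _ => isClosed_le continuous_const ?_
  exact continuous_quad.comp (continuous_id.prodMk continuous_const)

lemma isCompact_posSemidef {n : ℕ} (C d : ℝ) :
    IsCompact {A : Matrix (Fin n) (Fin n) ℝ | A.PosSemidef ∧ A.trace ≤ C ∧ d ≤ A.det} := by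
  have hbox : IsCompact (Set.univ.pi fun _ => Set.univ.pi fun _ => Set.Icc (-C) C :
      Set (Fin n → Fin n → ℝ)) :=
    isCompact_univ_pi fun _ => isCompact_univ_pi fun _ => isCompact_Icc
  refine IsCompact.of_isClosed_subset (X := Fin n → Fin n → ℝ) hbox ?_ ?_
  · refine IsClosed.inter ?_ (IsClosed.inter ?_ ?_)
    · have : {A : Matrix (Fin n) (Fin n) ℝ | A.PosSemidef} =
          {A | A.IsSymm} ∩ ⋂ x, {A | 0 ≤ quad A x} := by
        ext A
        simp [posSemidef_iff_quad]
      refine (congrArg IsClosed this).mpr ?_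
      refine IsClosed.inter ?_ (isClosed_iInter fun x => ?_)
      · exact isClosed_eq (continuous_id.matrix_transpose) continuous_id
      · exact isClosed_le continuous_const
          (continuous_quad.comp (continuous_id.prodMk continuous_const))
    · exact isClosed_le (Continuous.matrix_trace continuous_id) continuous_const
    · exact isClosed_le continuous_const (Continuous.matrix_det continuous_id)
  · rintro A ⟨hA, htr, -⟩ i - j -
    exact abs_le.1 ((abs_apply_le_trace hA i j).trans htr)

lemma posDef_of_det {n : ℕ} {A : Matrix (Fin n) (Fin n) ℝ} (hA : A.PosSemidef) {d : ℝ}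
    (hd : 0 < d) (h : d ≤ A.det) : A.PosDef :=
  hA.posDef_iff_det_ne_zero.2 (hd.trans_le h).ne'

lemma exists_mul_dotProduct_le_quad {n : ℕ} (C : ℝ) {d : ℝ} (hd : 0 < d) :
    ∃ c > 0, ∀ A : Matrix (Fin n) (Fin n) ℝ, A.PosSemidef → A.trace ≤ C → d ≤ A.det →
      ∀ x, c * (x ⬝ᵥ x) ≤ quad A x := by
  let S : Set (Fin n → ℝ) := {x | x ⬝ᵥ x = 1}
  have hS : IsCompact S := by
    refine IsCompact.of_isClosed_subset
      (isCompact_univ_pi fun _ : Fin n => isCompact_Icc (a := (-1 : ℝ)) (b := 1)) ?_ ?_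
    · exact isClosed_eq (Continuous.dotProduct continuous_id continuous_id) continuous_const
    · intro x hx i _
      have h1 : x i * x i ≤ x ⬝ᵥ x := Finset.single_le_sum (f := fun i => x i * x i)
        (fun i _ => mul_self_nonneg _) (Finset.mem_univ i)
      rw [show x ⬝ᵥ x = 1 from hx] at h1
      exact abs_le.1 (abs_le_one_iff_mul_self_le_one.2 h1)
  have hK := (isCompact_posSemidef (n := n) C d).prod hS
  obtain ⟨c, hc, hcK⟩ : ∃ c > 0, ∀ p ∈ {A : Matrix (Fin n) (Fin n) ℝ | A.PosSemidef ∧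
      A.trace ≤ C ∧ d ≤ A.det} ×ˢ S, c ≤ quad p.1 p.2 := by
    rcases Set.eq_empty_or_nonempty ({A : Matrix (Fin n) (Fin n) ℝ | A.PosSemidef ∧
      A.trace ≤ C ∧ d ≤ A.det} ×ˢ S) with h | h
    · exact ⟨1, one_pos, by simp [h]⟩
    · obtain ⟨p, hp, hmin⟩ := hK.exists_isMinOn h continuous_quad.continuousOn
      refine ⟨_, (posDef_iff_quad.1 (posDef_of_det hp.1.1 hd hp.1.2.2)).2 p.2 ?_, hmin⟩
      rintro h0
      have : p.2 ⬝ᵥ p.2 = 1 := hp.2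
      simp [h0] at this
  refine ⟨c, hc, fun A h1 h2 h3 x => ?_⟩
  rcases eq_or_ne x 0 with rfl | hx
  · simp [quad]
  have h0 := dotProduct_self_pos hx
  have hr : 0 < √(x ⬝ᵥ x) := Real.sqrt_pos.2 h0
  have hsq : √(x ⬝ᵥ x) ^ 2 = x ⬝ᵥ x := Real.sq_sqrt h0.le
  have h4 := hcK (A, (√(x ⬝ᵥ x))⁻¹ • x) ⟨⟨h1, h2, h3⟩, by
    change _ ⬝ᵥ _ = _
    simp only [smul_dotProduct, dotProduct_smul, smul_eq_mul]
    rw [← mul_assoc, ← mul_inv, ← pow_two, hsq, inv_mul_cancel₀ h0.ne']⟩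
  have h5 : quad A ((√(x ⬝ᵥ x))⁻¹ • x) = (x ⬝ᵥ x)⁻¹ * quad A x := by
    simp only [quad, mulVec_smul, smul_dotProduct, dotProduct_smul, smul_eq_mul]
    rw [← mul_assoc, ← mul_inv, ← pow_two, hsq]
  change c ≤ quad A _ at h4
  rw [h5, inv_mul_eq_div, le_div_iff₀ h0] at h4
  exact h4

lemma continuousOn_energy {n : ℕ} {X : Finset (Fin n → ℝ)} {τ : ℝ} (hτ : 0 < τ) :
    ContinuousOn (energy X τ) {A | 0 < A.det ∧ ∀ x ∈ X, 1 ≤ quad A x} := by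
  refine (ContinuousOn.add ?_ (continuousOn_finsetSum _ fun x hx => ?_)).add ?_
  · exact (Continuous.matrix_det continuous_id).continuousOn.log fun A hA => hA.1.ne'
  · intro A hA
    have hq : 0 < quad A x := one_pos.trans_le (hA.2 x hx)
    refine ContinuousAt.continuousWithinAt ?_
    refine ContinuousAt.comp (f := fun A => quad A x) (g := fun q => barrier (Real.log q) τ)
      (hasDerivAt_barrier_log hτ hq).continuousAt ?_
    exact (continuous_quad.comp (continuous_id.prodMk continuous_const)).continuousAt
  · exact ((Continuous.matrix_trace continuous_id).div_const _).continuousOn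

lemma exists_energy_minimizer {n : ℕ} (hn : 0 < n) {Λ : Set (Fin n → ℝ)}
    (hΛ : ∀ x ∈ Λ, 1 ≤ x ⬝ᵥ x) {X : Finset (Fin n → ℝ)} (hX : ∀ x ∈ X, x ∈ Λ) {τ : ℝ}
    (hτ : 0 < τ) {l E : ℝ}
    (hdet : ∀ A : Matrix (Fin n) (Fin n) ℝ, A.PosDef → (∀ x ∈ Λ, 1 ≤ quad A x) → l < Real.log A.det)
    (hE : energy X τ (1 : Matrix (Fin n) (Fin n) ℝ) ≤ E) :
    ∃ A : Matrix (Fin n) (Fin n) ℝ, A.PosDef ∧ A.trace ≤ n * (E - l) ∧ Real.exp l ≤ A.det ∧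
      (∀ x ∈ Λ, 1 ≤ quad A x) ∧ ∀ A' : Matrix (Fin n) (Fin n) ℝ, A'.PosDef →
        (∀ x ∈ Λ, 1 ≤ quad A' x) → energy X τ A ≤ energy X τ A' := by
  have hn' : (0 : ℝ) < n := by exact_mod_cast hn
  let K := {A : Matrix (Fin n) (Fin n) ℝ | A.PosSemidef ∧ A.trace ≤ n * (E - l) ∧ Real.exp l ≤ A.det}
    ∩ {A | ∀ x ∈ Λ, 1 ≤ quad A x}
  have hK : IsCompact K := (isCompact_posSemidef _ _).inter_right (isClosed_one_le_quad Λ)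
  have hmem : ∀ A : Matrix (Fin n) (Fin n) ℝ, A.PosDef → (∀ x ∈ Λ, 1 ≤ quad A x) →
      energy X τ A ≤ E → A ∈ K := by
    intro A hA hf hAE
    have h1 := hdet A hA hf
    refine ⟨⟨hA.posSemidef, ?_, ?_⟩, hf⟩
    · have h2 : 0 ≤ ∑ x ∈ X, barrier (Real.log (quad A x)) τ :=
        Finset.sum_nonneg fun x _ => barrier_nonneg hτ.le _
      unfold energy at hAE
      have h3 : A.trace / n ≤ E - l := by linarith
      rw [div_le_iff₀ hn'] at h3
      linarith
    · exact ((Real.lt_log_iff_exp_lt hA.det_pos).1 h1).le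
  have h1 : (1 : Matrix (Fin n) (Fin n) ℝ) ∈ K :=
    hmem 1 Matrix.PosDef.one (fun x hx => by rw [quad_one]; exact hΛ x hx) hE
  obtain ⟨A, hA, hmin⟩ := hK.exists_isMinOn ⟨1, h1⟩ ((continuousOn_energy (X := X) hτ).mono
    fun A hA => ⟨(Real.exp_pos l).trans_le hA.1.2.2, fun x hx => hA.2 x (hX x hx)⟩)
  refine ⟨A, posDef_of_det hA.1.1 (Real.exp_pos l) hA.1.2.2, hA.1.2.1, hA.1.2.2, hA.2,
    fun A' hA' hf => ?_⟩
  rcases le_or_gt (energy X τ A') E with h | h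
  · exact hmin (hmem A' hA' hf h)
  · exact ((hmin h1).trans hE).trans h.le

/-- If the total barrier of the vectors of `Λ` lying in a large ball is small, then some positive
definite form of small determinant is at least one on `Λ`. -/
theorem exists_posDef_log_det_le {n : ℕ} (hn : 0 < n) {T τ₀ : ℝ} (C₀ : ℝ) (hT : 0 ≤ T)
    (hτ₀ : 0 < τ₀) :
    ∃ R : ℝ, ∀ (Λ : Set (Fin n → ℝ)) (X : Finset (Fin n → ℝ)),
      (∀ x, x ∈ X ↔ x ∈ Λ ∧ x ⬝ᵥ x ≤ R) → (∀ x ∈ Λ, 1 ≤ x ⬝ᵥ x) →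
      ∑ x ∈ X, barrier (Real.log (x ⬝ᵥ x)) (T + τ₀) ≤ C₀ →
      ∃ A : Matrix (Fin n) (Fin n) ℝ, A.PosDef ∧ (∀ x ∈ Λ, 1 ≤ quad A x) ∧
        Real.log A.det ≤ C₀ + 1 - n * (n + 1) / 4 * T := by
  set N : ℝ := n * (n + 1) / 4 with hN
  have hN0 : 0 ≤ N := by positivity
  have hn' : (0 : ℝ) < n := by exact_mod_cast hn
  set l := C₀ + 1 - N * T with hl
  obtain ⟨c, hc, hcA⟩ := exists_mul_dotProduct_le_quad (n := n) (n * (C₀ + 1 - l)) (Real.exp_pos l)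
  refine ⟨2 / c, fun Λ X hX hΛ hsum => ?_⟩
  by_contra! hdet
  have hXΛ : ∀ x ∈ X, x ∈ Λ := fun x hx => ((hX x).1 hx).1
  have hE : ∀ t, 0 ≤ t → t ≤ T → energy X (T + τ₀ - t) (1 : Matrix (Fin n) (Fin n) ℝ) ≤ C₀ + 1 := by
    intro t h0 h1
    simp only [energy, quad_one, det_one, Real.log_one, zero_add, trace_one, Fintype.card_fin]
    rw [div_self hn'.ne']
    gcongr
    refine le_trans (Finset.sum_le_sum fun x _ => ?_) hsum
    exact barrier_monotoneOn _ (show 0 < T + τ₀ - t by linarith) (show 0 < T + τ₀ by linarith)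
      (by linarith)
  have hex : ∀ t, ∃ A : Matrix (Fin n) (Fin n) ℝ, 0 ≤ t → t ≤ T →
      A.PosDef ∧ A.trace ≤ n * (C₀ + 1 - l) ∧ Real.exp l ≤ A.det ∧ (∀ x ∈ Λ, 1 ≤ quad A x) ∧
      ∀ A' : Matrix (Fin n) (Fin n) ℝ, A'.PosDef →
        (∀ x ∈ Λ, 1 ≤ quad A' x) → energy X (T + τ₀ - t) A ≤ energy X (T + τ₀ - t) A' := by
    intro t
    by_cases h : 0 ≤ t ∧ t ≤ T
    · obtain ⟨A, hA⟩ := exists_energy_minimizer hn hΛ hXΛ (τ := T + τ₀ - t) (by linarith) hdet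
        (hE t h.1 h.2)
      exact ⟨A, fun _ _ => hA⟩
    · exact ⟨1, fun h0 h1 => absurd ⟨h0, h1⟩ h⟩
  choose A hA using hex
  let f : ℝ → ℝ := fun t => energy X (T + τ₀ - t) (A t) + N * t
  have hf : f T ≤ f 0 := by
    refine le_of_forall_exists_gt hT hN0 (fun s t h0 hst htT => ?_) fun t h0 htT η hη => ?_
    · have h1 := (hA t (h0.trans hst) htT).2.2.2.2 (A s) (hA s h0 (hst.trans htT)).1
        (hA s h0 (hst.trans htT)).2.2.2.1
      have h2 : energy X (T + τ₀ - t) (A s) ≤ energy X (T + τ₀ - s) (A s) := by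
        unfold energy
        gcongr with x hx
        exact barrier_monotoneOn _ (show 0 < T + τ₀ - t by linarith)
          (show 0 < T + τ₀ - s by linarith) (by linarith)
      simp only [f]
      linarith
    · obtain ⟨hpos, htr, hd, hfeas, hmin⟩ := hA t h0 htT.le
      have hτ : 0 < T + τ₀ - t := by linarith
      have hball : ∀ x ∈ Λ, quad (A t) x ≤ 2 → x ∈ X := by
        intro x hx h2
        refine (hX x).2 ⟨hx, ?_⟩
        rw [le_div_iff₀ hc]
        linarith [hcA _ hpos.posSemidef htr hd x]
      have hrate := card_le_sum_barrierRate hpos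
        (X.finite_toSet.subset fun x hx => hball x hx.1 hx.2) hfeas hXΛ
        (fun x hx h => hball x hx (by linarith)) hτ hmin
      let g : ℝ → ℝ := fun s => energy X (T + τ₀ - s) (A t) + N * s
      have hg : HasDerivAt g
          ((0 + ∑ x ∈ X, barrierRate (Real.log (quad (A t) x)) (T + τ₀ - t) * (-1) + 0) + N * 1)
          t := by
        refine HasDerivAt.add (HasDerivAt.add (HasDerivAt.add (hasDerivAt_const t _)
          (HasDerivAt.fun_sum fun x _ => ?_)) (hasDerivAt_const t _))
          ((hasDerivAt_id t).const_mul N)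
        exact HasDerivAt.comp (h₂ := fun τ => barrier (Real.log (quad (A t) x)) τ) t
          (hasDerivAt_barrier_time hτ _) ((hasDerivAt_id t).const_sub _)
      have hg' := hg.hasDerivWithinAt (s := Set.Ioi t)
      rw [hasDerivWithinAt_iff_tendsto_slope' (by simp)] at hg'
      have hlt := hg'.eventually_lt_const (u := η) (by
        rw [← Finset.sum_mul]
        linarith)
      have hIoc : ∀ᶠ s in 𝓝[>] t, s ∈ Set.Ioc t T := Ioc_mem_nhdsGT htT
      obtain ⟨s, hs, hts, hsT⟩ := (hlt.and hIoc).exists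
      refine ⟨s, hts, hsT, ?_⟩
      rw [slope_def_field, div_lt_iff₀ (sub_pos.2 hts)] at hs
      have h1 := (hA s (h0.trans hts.le) hsT).2.2.2.2 (A t) hpos hfeas
      simp only [g, f] at hs ⊢
      linarith
  obtain ⟨hpos, -, -, hfeas, -⟩ := hA T hT le_rfl
  have h0 := (hA 0 le_rfl hT).2.2.2.2 1 Matrix.PosDef.one
    (fun x hx => by rw [quad_one]; exact hΛ x hx)
  have h1 := hE 0 le_rfl hT
  have h2 := hdet (A T) hpos hfeas
  have h3 : Real.log (A T).det ≤ energy X (T + τ₀ - T) (A T) := by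
    have h4 : 0 ≤ ∑ x ∈ X, barrier (Real.log (quad (A T) x)) (T + τ₀ - T) :=
      Finset.sum_nonneg fun x _ => barrier_nonneg (by linarith) _
    have h5 : 0 ≤ (A T).trace / n := div_nonneg hpos.posSemidef.trace_nonneg hn'.le
    unfold energy
    linarith
  simp only [f] at hf
  linarith

/-- The closed Euclidean unit ball, inside the coordinate space. -/
def unitBall (n : ℕ) : Set (Fin n → ℝ) := {x | x ⬝ᵥ x ≤ 1}

lemma image_toLp_unitBall (n : ℕ) :
    unitBall n = WithLp.toLp 2 ⁻¹' Metric.closedBall (0 : EuclideanSpace ℝ (Fin n)) 1 := by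
  ext x
  rw [Set.mem_preimage, mem_closedBall_zero_iff, ← sq_le_one_iff₀ (norm_nonneg _),
    EuclideanSpace.norm_sq_eq]
  simp [unitBall, dotProduct, pow_two]

lemma volume_unitBall (n : ℕ) :
    volume (unitBall n) = volume (Metric.closedBall (0 : EuclideanSpace ℝ (Fin n)) 1) := by
  rw [image_toLp_unitBall]
  exact (PiLp.volume_preserving_toLp (Fin n)).measure_preimage
    measurableSet_closedBall.nullMeasurableSet

lemma isCompact_unitBall (n : ℕ) : IsCompact (unitBall n) := by
  rw [image_toLp_unitBall]
  exact (PiLp.homeomorph 2 _).symm.isCompact_preimage.2 (isCompact_closedBall _ _)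

lemma convex_unitBall (n : ℕ) : Convex ℝ (unitBall n) := by
  rw [image_toLp_unitBall]
  exact (convex_closedBall (0 : EuclideanSpace ℝ (Fin n)) 1).linear_preimage
    (WithLp.linearEquiv 2 ℝ (Fin n → ℝ)).symm.toLinearMap

lemma volume_unitBall_pos (n : ℕ) : 0 < volume.real (unitBall n) := by
  rw [measureReal_def, volume_unitBall]
  exact ENNReal.toReal_pos (Metric.measure_closedBall_pos _ _ one_pos).ne'
    measure_closedBall_lt_top.ne

lemma finite_int_sum_sq_le (n : ℕ) (r : ℝ) : {z : Fin n → ℤ | ∑ i, (z i : ℝ) ^ 2 ≤ r}.Finite := by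
  refine (Set.finite_Icc (fun _ : Fin n => -⌊r⌋) (fun _ => ⌊r⌋)).subset fun z hz => ?_
  have h : ∀ i, |z i| ≤ ⌊r⌋ := by
    intro i
    rw [Int.le_floor]
    have h1 : ((z i : ℝ)) ^ 2 ≤ ∑ i, (z i : ℝ) ^ 2 :=
      Finset.single_le_sum (f := fun i => (z i : ℝ) ^ 2) (fun i _ => sq_nonneg _) (Finset.mem_univ i)
    have h2 : |z i| ≤ z i ^ 2 := by
      rw [← sq_abs]
      exact Int.le_self_sq _
    have h3 : ((|z i| : ℤ) : ℝ) ≤ (z i : ℝ) ^ 2 := by exact_mod_cast h2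
    exact h3.trans (h1.trans hz)
  exact ⟨fun i => (abs_le.1 (h i)).1, fun i => (abs_le.1 (h i)).2⟩

lemma exists_card_int_le (n : ℕ) : ∃ s₀ : ℝ, 0 < s₀ ∧ ∀ s, s₀ ≤ s → ∀ S : Finset (Fin n → ℤ),
    (∀ z ∈ S, ∑ i, (z i : ℝ) ^ 2 ≤ s ^ 2) → (S.card : ℝ) ≤ 2 * volume.real (unitBall n) * s ^ n := by
  have hpos := volume_unitBall_pos n
  have h0 : (0 : Fin n → ℝ) ∈ unitBall n := by simp [unitBall]
  have hlim := tendsto_card_div_pow_atTop_volume' (unitBall n) (isCompact_unitBall n).isBounded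
    (isCompact_unitBall n).measurableSet ((convex_unitBall n).addHaar_frontier volume) (by
      rintro x y hx hxy _ ⟨u, hu, rfl⟩
      refine ⟨(x / y) • u, (convex_unitBall n).smul_mem_of_zero_mem h0 hu
        ⟨div_nonneg hx.le (hx.le.trans hxy), div_le_one_of_le₀ hxy (hx.le.trans hxy)⟩, ?_⟩
      have : y ≠ 0 := (hx.trans_le hxy).ne'
      simp only [smul_smul]
      rw [mul_div_cancel₀ _ this])
  obtain ⟨s₁, hs₁⟩ := eventually_atTop.1 (hlim.eventually_lt_const (by linarith :
    volume.real (unitBall n) < 2 * volume.real (unitBall n)))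
  refine ⟨max s₁ 1, by positivity, fun s hs S hS => ?_⟩
  have hs0 : 0 < s := one_pos.trans_le ((le_max_right _ _).trans hs)
  have h := hs₁ s ((le_max_left _ _).trans hs)
  rw [Fintype.card_fin, div_lt_iff₀ (by positivity)] at h
  refine le_trans ?_ h.le
  let ψ : (Fin n → ℤ) → (Fin n → ℝ) := fun z => s⁻¹ • fun i => (z i : ℝ)
  have hψ : Function.Injective ψ := by
    intro z w hzw
    have := smul_right_injective _ (inv_ne_zero hs0.ne') hzw
    funext i
    exact_mod_cast congrFun this i
  have hψmem : ∀ z, ψ z ∈ unitBall n ↔ ∑ i, (z i : ℝ) ^ 2 ≤ s ^ 2 := by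
    intro z
    have : ψ z ⬝ᵥ ψ z = (∑ i, (z i : ℝ) ^ 2) / s ^ 2 := by
      simp only [ψ, dotProduct, Pi.smul_apply, smul_eq_mul, Finset.sum_div]
      exact Finset.sum_congr rfl fun i _ => by field_simp
    change ψ z ⬝ᵥ ψ z ≤ 1 ↔ _
    rw [this, div_le_one (by positivity)]
  have hL : ∀ z : Fin n → ℤ, (fun i => (z i : ℝ)) ∈
      Submodule.span ℤ (Set.range (Pi.basisFun ℝ (Fin n))) := by
    intro z
    rw [Module.Basis.mem_span_iff_repr_mem]
    exact fun i => ⟨z i, by simp⟩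
  set D := unitBall n ∩ s⁻¹ • (Submodule.span ℤ (Set.range (Pi.basisFun ℝ (Fin n))) : Set (Fin n → ℝ))
    with hD
  have hDfin : D.Finite := by
    refine ((finite_int_sum_sq_le n (s ^ 2)).image ψ).subset ?_
    rintro _ ⟨hx, u, hu, rfl⟩
    have hu' : u ∈ Submodule.span ℤ (Set.range (Pi.basisFun ℝ (Fin n))) := hu
    rw [Module.Basis.mem_span_iff_repr_mem] at hu'
    choose z hz using hu'
    have hzu : (fun i => (z i : ℝ)) = u := by
      funext i
      simpa using hz i
    refine ⟨z, ?_, by simp [ψ, hzu]⟩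
    change ∑ i, (z i : ℝ) ^ 2 ≤ s ^ 2
    rw [← hψmem]
    simpa [ψ, hzu] using hx
  have hsub : ψ '' S ⊆ D := by
    rintro _ ⟨z, hz, rfl⟩
    exact ⟨(hψmem z).2 (hS z hz), _, hL z, rfl⟩
  have := Set.ncard_le_ncard hsub hDfin
  rw [Set.ncard_image_of_injective _ hψ, Set.ncard_coe_finset] at this
  exact_mod_cast this

/-- A basis of the lattice of all integer vectors `z` satisfying `z (i + 1) ≡ v i * z 0` modulo
`p` for every `i`. -/
def congruenceBasis {k p : ℕ} (v : Fin k → Fin p) : Matrix (Fin (k + 1)) (Fin (k + 1)) ℤ :=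
  Matrix.of fun i j => Fin.cases (if j = 0 then 1 else 0)
    (fun i' => if j = 0 then ((v i' : ℕ) : ℤ) else if j = i'.succ then (p : ℤ) else 0) i

lemma congruenceBasis_mulVec_zero {k p : ℕ} (v : Fin k → Fin p) (m : Fin (k + 1) → ℤ) :
    (congruenceBasis v *ᵥ m) 0 = m 0 := by
  simp [congruenceBasis, mulVec, dotProduct]

lemma congruenceBasis_mulVec_succ {k p : ℕ} (v : Fin k → Fin p) (m : Fin (k + 1) → ℤ) (i : Fin k) :
    (congruenceBasis v *ᵥ m) i.succ = (v i : ℕ) * m 0 + p * m i.succ := by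
  simp [congruenceBasis, mulVec, dotProduct, Fin.sum_univ_succ, Fin.succ_ne_zero]

lemma det_congruenceBasis {k p : ℕ} (v : Fin k → Fin p) : (congruenceBasis v).det = (p : ℤ) ^ k := by
  rw [det_of_isLowerTriangular]
  · rw [Fin.prod_univ_succ]
    simp [congruenceBasis, Fin.succ_ne_zero]
  · intro i j hij
    replace hij : i < j := hij
    induction i using Fin.cases with
    | zero => simp [congruenceBasis, hij.ne']
    | succ i => simp [congruenceBasis, hij.ne', ((Fin.succ_pos i).trans hij).ne']

lemma congruenceBasis_injective {k p : ℕ} (hp : p.Prime) {v w : Fin k → Fin p}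
    {m l : Fin (k + 1) → ℤ} (hm : ¬ (p : ℤ) ∣ m 0)
    (h : congruenceBasis v *ᵥ m = congruenceBasis w *ᵥ l) : v = w ∧ m = l := by
  have h0 : m 0 = l 0 := by
    simpa only [congruenceBasis_mulVec_zero] using congrFun h 0
  have h1 : ∀ i, ((v i : ℕ) : ℤ) * m 0 + p * m i.succ = (w i : ℕ) * m 0 + p * l i.succ := by
    intro i
    have := congrFun h i.succ
    rwa [congruenceBasis_mulVec_succ, congruenceBasis_mulVec_succ, ← h0] at this
  have hvw : v = w := by
    funext i
    have h2 : (p : ℤ) ∣ (((v i : ℕ) : ℤ) - (w i : ℕ)) * m 0 :=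
      ⟨l i.succ - m i.succ, by linarith [h1 i]⟩
    have h3 := ((Nat.prime_iff_prime_int.1 hp).dvd_or_dvd h2).resolve_right hm
    have h4 := Int.eq_zero_of_abs_lt_dvd h3 (by
      have := (v i).2
      have := (w i).2
      rw [abs_lt]
      omega)
    exact Fin.ext (by omega)
  subst hvw
  refine ⟨rfl, funext fun i => ?_⟩
  induction i using Fin.cases with
  | zero => exact h0
  | succ i =>
    have h2 := h1 i
    have h3 : (p : ℤ) ≠ 0 := by exact_mod_cast hp.ne_zero
    exact mul_left_cancel₀ h3 (by linarith)

lemma sq_le_sum_sq_congruenceBasis {k p : ℕ} (v : Fin k → Fin p) {m : Fin (k + 1) → ℤ}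
    (hm : m ≠ 0) (hdvd : (p : ℤ) ∣ m 0) :
    (p : ℝ) ^ 2 ≤ ∑ i, ((congruenceBasis v *ᵥ m) i : ℝ) ^ 2 := by
  obtain ⟨i, hi, hi'⟩ : ∃ i, (congruenceBasis v *ᵥ m) i ≠ 0 ∧
      (p : ℤ) ∣ (congruenceBasis v *ᵥ m) i := by
    by_cases h0 : m 0 = 0
    · obtain ⟨j, hj⟩ := Function.ne_iff.1 hm
      induction j using Fin.cases with
      | zero => exact absurd h0 hj
      | succ j =>
        have hv := congruenceBasis_mulVec_succ v m j
        rw [h0, mul_zero, zero_add] at hv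
        have hp : (p : ℤ) ≠ 0 := by
          have := (v j).2
          omega
        exact ⟨j.succ, by rw [hv]; exact mul_ne_zero hp hj, by rw [hv]; exact dvd_mul_right _ _⟩
    · refine ⟨0, ?_, ?_⟩
      · rwa [congruenceBasis_mulVec_zero]
      · rwa [congruenceBasis_mulVec_zero]
  have h1 : (p : ℤ) ≤ |(congruenceBasis v *ᵥ m) i| :=
    Int.le_of_dvd (abs_pos.2 hi) ((dvd_abs _ _).2 hi')
  have h2 : (p : ℤ) ^ 2 ≤ (congruenceBasis v *ᵥ m) i ^ 2 := by
    rw [← sq_abs ((congruenceBasis v *ᵥ m) i)]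
    gcongr
  have h3 : ((congruenceBasis v *ᵥ m) i : ℝ) ^ 2 ≤ ∑ i, ((congruenceBasis v *ᵥ m) i : ℝ) ^ 2 :=
    Finset.single_le_sum (f := fun i => ((congruenceBasis v *ᵥ m) i : ℝ) ^ 2)
      (fun i _ => sq_nonneg _) (Finset.mem_univ i)
  exact le_trans (by exact_mod_cast h2) h3

/-- There are lattices of bounded covolume for which the unit ball contains no nonzero lattice point
and the total barrier of the lattice points in a given ball is bounded by its expected order. -/
theorem exists_lattice_sum_barrier_le {k : ℕ} (hk : 0 < k) {τ : ℝ} (hτ : 0 < τ) (R : ℝ) :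
    ∃ M : Matrix (Fin (k + 1)) (Fin (k + 1)) ℝ,
      M.det = 8 * volume.real (unitBall (k + 1)) ∧
      (∀ m : Fin (k + 1) → ℤ, m ≠ 0 →
        1 ≤ (M *ᵥ fun i => (m i : ℝ)) ⬝ᵥ (M *ᵥ fun i => (m i : ℝ))) ∧
      ∃ X : Finset (Fin (k + 1) → ℝ),
        (∀ x, x ∈ X ↔ x ∈ {x | ∃ m : Fin (k + 1) → ℤ, m ≠ 0 ∧ (M *ᵥ fun i => (m i : ℝ)) = x} ∧
          x ⬝ᵥ x ≤ R) ∧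
        ∑ x ∈ X, barrier (Real.log (x ⬝ᵥ x)) τ ≤
          2 / (((k + 1 : ℕ) : ℝ) / 2) ^ 2 *
            Real.exp (((((k + 1 : ℕ) : ℝ) / 2) ^ 2 + ((k + 1 : ℕ) : ℝ) / 2) * τ / 2) := by
  classical
  set n := k + 1 with hn
  set ω := volume.real (unitBall n) with hω
  have hω0 : 0 < ω := volume_unitBall_pos n
  set l : ℝ := (n : ℝ) / 2 with hl
  have hl0 : 0 < l := by positivity
  set H := 2 / l ^ 2 * Real.exp ((l ^ 2 + l) * τ / 2) with hH
  have hH0 : 0 < H := by positivity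
  obtain ⟨s₀, hs₀, hcount⟩ := exists_card_int_le n
  set R' := max R 1 with hR'
  have hR'1 : 1 ≤ R' := le_max_right _ _
  obtain ⟨p, hple, hp⟩ := Nat.exists_infinite_primes
    (⌈8 * ω * s₀ ^ n⌉₊ + (⌊R' ^ n / (8 * ω)⌋₊ + 1))
  have hp1 : 8 * ω * s₀ ^ n ≤ p :=
    (Nat.le_ceil _).trans (by exact_mod_cast (Nat.le_add_right _ _).trans hple)
  have hp2 : R' ^ n / (8 * ω) < p :=
    (Nat.lt_floor_add_one _).trans_le (by exact_mod_cast (Nat.le_add_left _ _).trans hple)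
  have hp0 : (1 : ℝ) ≤ p := by exact_mod_cast hp.one_lt.le
  have hpk : (p : ℝ) ≤ (p : ℝ) ^ k := le_self_pow₀ hp0 hk.ne'
  have hpk0 : (0 : ℝ) < (p : ℝ) ^ k := by positivity
  obtain ⟨σ, hσ0, hσ⟩ : ∃ σ : ℝ, 0 < σ ∧ σ ^ n = 8 * ω / (p : ℝ) ^ k :=
    ⟨(8 * ω / (p : ℝ) ^ k) ^ ((n : ℝ)⁻¹), by positivity,
      Real.rpow_inv_natCast_pow (by positivity) (by omega)⟩
  have hσs : s₀ ≤ 1 / σ := by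
    rw [le_div_iff₀ hσ0]
    refine le_of_pow_le_pow_left₀ (n := n) (by omega) one_pos.le ?_
    rw [mul_pow, hσ, one_pow, ← mul_div_assoc, div_le_one hpk0]
    linarith
  have hσp : R' < σ * p := by
    refine lt_of_pow_lt_pow_left₀ n (by positivity) ?_
    rw [mul_pow, hσ, hn, pow_succ (p : ℝ) k, div_mul_eq_mul_div, ← mul_assoc, mul_right_comm,
      mul_div_cancel_right₀ _ hpk0.ne', ← hn]
    rw [div_lt_iff₀ (by positivity)] at hp2
    linarith
  let Φ : (Fin k → Fin p) × (Fin n → ℤ) → (Fin n → ℤ) := fun s => congruenceBasis s.1 *ᵥ s.2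
  let N : (Fin k → Fin p) × (Fin n → ℤ) → ℝ := fun s => σ ^ 2 * ∑ i, (Φ s i : ℝ) ^ 2
  let P : Set ((Fin k → Fin p) × (Fin n → ℤ)) := {s | s.2 ≠ 0 ∧ N s ≤ R'}
  have hPdvd : ∀ s ∈ P, ¬ (p : ℤ) ∣ s.2 0 := by
    rintro s ⟨h1, h2⟩ h3
    have h4 : σ ^ 2 * (p : ℝ) ^ 2 ≤ N s :=
      mul_le_mul_of_nonneg_left (sq_le_sum_sq_congruenceBasis s.1 h1 h3) (sq_nonneg _)
    nlinarith
  have hinj : Set.InjOn Φ P := fun s hs t ht hst => by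
    have := congruenceBasis_injective hp (hPdvd s hs) hst
    exact Prod.ext this.1 this.2
  have hPfin : P.Finite := by
    refine Set.Finite.of_finite_image ((finite_int_sum_sq_le n (R' / σ ^ 2)).subset ?_) hinj
    rintro _ ⟨s, hs, rfl⟩
    change ∑ i, (Φ s i : ℝ) ^ 2 ≤ _
    rw [le_div_iff₀' (by positivity)]
    exact hs.2
  have hcard : ∀ (S : Finset ((Fin k → Fin p) × (Fin n → ℤ))) (ρ : ℝ), (∀ s ∈ S, s ∈ P) → 1 ≤ ρ →
      (∀ s ∈ S, N s ≤ ρ ^ 2) → (S.card : ℝ) ≤ (p : ℝ) ^ k / 4 * ρ ^ n := by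
    intro S ρ hSP hρ hS
    rw [← Finset.card_image_of_injOn (hinj.mono hSP)]
    have h1 : s₀ ≤ ρ / σ := hσs.trans (by gcongr)
    refine (hcount (ρ / σ) h1 (S.image Φ) ?_).trans (le_of_eq ?_)
    · intro z hz
      obtain ⟨s, hs, rfl⟩ := Finset.mem_image.1 hz
      rw [div_pow, le_div_iff₀' (by positivity)]
      exact hS s hs
    · rw [div_pow, hσ]
      rw [← hω]
      field_simp
      norm_num
  let S₁ := hPfin.toFinset.filter fun s => N s ≤ 1
  let S₂ := hPfin.toFinset.filter fun s => 1 < N s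
  have hS₁ : (S₁.card : ℝ) ≤ (p : ℝ) ^ k / 4 := by
    have := hcard S₁ 1 (fun s hs => hPfin.mem_toFinset.1 (Finset.mem_filter.1 hs).1) le_rfl
      (fun s hs => by simpa using (Finset.mem_filter.1 hs).2)
    simpa using this
  have hS₂ : ∑ s ∈ S₂, barrier (Real.log (N s)) τ ≤ (p : ℝ) ^ k / 4 * H := by
    refine sum_barrier_le S₂ (fun s => Real.log (N s))
      (fun s hs => Real.log_nonneg (Finset.mem_filter.1 hs).2.le) (by positivity) hl0 hτ
      fun w hw => ?_
    have hexp : Real.exp (l * w) = Real.exp (w / 2) ^ n := by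
      rw [← Real.exp_nat_mul]
      congr 1
      rw [hl]
      ring
    rw [hexp]
    refine hcard _ _ (fun s hs => ?_) (Real.one_le_exp (by positivity)) fun s hs => ?_
    · exact hPfin.mem_toFinset.1 (Finset.mem_filter.1 (Finset.mem_filter.1 hs).1).1
    · obtain ⟨hs, hsw⟩ := Finset.mem_filter.1 hs
      have h1 : 0 < N s := one_pos.trans (Finset.mem_filter.1 hs).2
      rw [← Real.exp_nat_mul]
      refine ((Real.log_lt_iff_lt_exp h1).1 hsw).le.trans (le_of_eq ?_)
      congr 1
      push_cast
      ring
  obtain ⟨v, hv₁, hv₂⟩ : ∃ v : Fin k → Fin p, (S₁.filter fun s => s.1 = v).card = 0 ∧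
      ∑ s ∈ S₂ with s.1 = v, barrier (Real.log (N s)) τ ≤ H := by
    by_contra! hcon
    have hge : ∀ v : Fin k → Fin p, (1 : ℝ) ≤ ∑ _s ∈ S₁ with _s.1 = v, (1 : ℝ) +
        (∑ s ∈ S₂ with s.1 = v, barrier (Real.log (N s)) τ) / H := by
      intro v
      rw [Finset.sum_const, nsmul_one]
      have h0 : 0 ≤ (∑ s ∈ S₂ with s.1 = v, barrier (Real.log (N s)) τ) / H :=
        div_nonneg (Finset.sum_nonneg fun s _ => barrier_nonneg hτ.le _) hH0.le
      rcases Nat.eq_zero_or_pos (S₁.filter fun s => s.1 = v).card with h | h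
      · have := (one_lt_div hH0).2 (hcon v h)
        rw [h, Nat.cast_zero]
        linarith
      · have : (1 : ℝ) ≤ (S₁.filter fun s => s.1 = v).card := by exact_mod_cast h
        linarith
    have hsum := Finset.sum_le_sum fun v (_ : v ∈ Finset.univ) => hge v
    rw [Finset.sum_add_distrib, ← Finset.sum_div, Finset.sum_fiberwise, Finset.sum_fiberwise,
      Finset.sum_const, Finset.sum_const, nsmul_one, nsmul_one, Finset.card_univ, Fintype.card_fun,
      Fintype.card_fin, Fintype.card_fin] at hsum
    push_cast at hsum
    have h1 : (∑ s ∈ S₂, barrier (Real.log (N s)) τ) / H ≤ (p : ℝ) ^ k / 4 := by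
      rwa [div_le_iff₀ hH0]
    linarith
  let M : Matrix (Fin n) (Fin n) ℝ := σ • (congruenceBasis v).map (Int.castRingHom ℝ)
  have hM : ∀ m : Fin n → ℤ, (M *ᵥ fun i => (m i : ℝ)) = σ • fun i => (Φ (v, m) i : ℝ) := by
    intro m
    rw [smul_mulVec]
    congr 1
    funext i
    exact (RingHom.map_mulVec (Int.castRingHom ℝ) (congruenceBasis v) m i).symm
  have hMN : ∀ m : Fin n → ℤ,
      (M *ᵥ fun i => (m i : ℝ)) ⬝ᵥ (M *ᵥ fun i => (m i : ℝ)) = N (v, m) := by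
    intro m
    rw [hM, smul_dotProduct, dotProduct_smul, smul_eq_mul, smul_eq_mul, ← mul_assoc, ← pow_two]
    simp only [N, dotProduct, ← pow_two]
  have hone : ∀ m : Fin n → ℤ, m ≠ 0 → 1 < N (v, m) := by
    intro m hm
    by_contra! h
    refine Finset.eq_empty_iff_forall_notMem.1 (Finset.card_eq_zero.1 hv₁) (v, m) ?_
    simp only [S₁, Finset.mem_filter, Set.Finite.mem_toFinset, and_true]
    exact ⟨⟨hm, h.trans hR'1⟩, h⟩
  refine ⟨M, ?_, fun m hm => by rw [hMN]; exact (hone m hm).le, ?_⟩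
  · have hdet : ((congruenceBasis v).map (Int.castRingHom ℝ)).det = (p : ℝ) ^ k := by
      have := (Int.castRingHom ℝ).map_det (congruenceBasis v)
      rw [det_congruenceBasis] at this
      simpa using this.symm
    rw [det_smul, hdet, Fintype.card_fin, hσ]
    field_simp
  · let Q := (S₂.filter fun s => s.1 = v).filter fun s => N s ≤ R
    have hQ : ∀ s ∈ Q, s.1 = v ∧ s ∈ P := fun s hs => by
      simp only [Q, S₂, Finset.mem_filter, Set.Finite.mem_toFinset] at hs
      exact ⟨hs.1.2, hs.1.1.1⟩
    refine ⟨Q.image fun s => M *ᵥ fun i => (s.2 i : ℝ), fun x => ?_, ?_⟩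
    · constructor
      · intro hx
        obtain ⟨⟨v', m⟩, hs, rfl⟩ := Finset.mem_image.1 hx
        obtain ⟨rfl, hP⟩ := hQ _ hs
        refine ⟨⟨m, hP.1, rfl⟩, ?_⟩
        rw [hMN]
        exact (Finset.mem_filter.1 hs).2
      · rintro ⟨⟨m, hm, rfl⟩, hx⟩
        rw [hMN] at hx
        refine Finset.mem_image.2 ⟨(v, m), ?_, rfl⟩
        simp only [Q, S₂, Finset.mem_filter, Set.Finite.mem_toFinset, and_true]
        exact ⟨⟨⟨hm, hx.trans (le_max_left _ _)⟩, hone m hm⟩, hx⟩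
    · rw [Finset.sum_image]
      · refine le_trans (le_trans (le_of_eq ?_) (Finset.sum_le_sum_of_subset_of_nonneg
          (Finset.filter_subset (fun s => N s ≤ R) _) fun s _ _ => barrier_nonneg hτ.le _)) hv₂
        refine Finset.sum_congr rfl fun s hs => ?_
        rw [hMN, ← (hQ s hs).1]
      · intro s hs t ht hst
        have h1 := hQ s hs
        have h2 := hQ t ht
        refine hinj h1.2 h2.2 ?_
        simp only [hM] at hst
        have h3 := smul_right_injective _ hσ0.ne' hst
        have h4 : Φ (v, s.2) = Φ (v, t.2) := by
          funext i
          exact_mod_cast congrFun h3 i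
        change congruenceBasis s.1 *ᵥ s.2 = congruenceBasis t.1 *ᵥ t.2
        rw [h1.1, h2.1]
        exact h4

lemma barrier_constant_le {n : ℕ} (hn : 2 ≤ n) :
    2 / ((n : ℝ) / 2) ^ 2 * Real.exp ((((n : ℝ) / 2) ^ 2 + (n : ℝ) / 2) *
      (16 * Real.log n / (n * (n + 1)) + 1 / (n : ℝ) ^ 2) / 2) ≤ 8 * Real.exp 3 := by
  have hn' : (2 : ℝ) ≤ n := by exact_mod_cast hn
  have hn0 : (0 : ℝ) < n := by linarith
  have hlog : Real.log n ≤ n + 1 := (Real.log_le_sub_one_of_pos hn0).trans (by linarith)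
  have h1 : (((n : ℝ) / 2) ^ 2 + (n : ℝ) / 2) *
      (16 * Real.log n / (n * (n + 1)) + 1 / (n : ℝ) ^ 2) / 2 =
      2 * Real.log n + 2 * (Real.log n / (n + 1)) + (n + 2) / (8 * n) := by
    field_simp
    ring
  have h2 : Real.log n / (n + 1) ≤ 1 := (div_le_one (by linarith)).2 hlog
  have h3 : ((n : ℝ) + 2) / (8 * n) ≤ 1 := (div_le_one (by linarith)).2 (by linarith)
  have h4 : Real.exp (2 * Real.log n) = (n : ℝ) ^ 2 := by
    rw [mul_comm, Real.exp_mul, Real.exp_log hn0]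
    norm_cast
  rw [h1]
  calc _ ≤ 2 / ((n : ℝ) / 2) ^ 2 * Real.exp (2 * Real.log n + 3) := by
        exact mul_le_mul_of_nonneg_left (Real.exp_le_exp.2 (by linarith)) (by positivity)
    _ = 8 * Real.exp 3 := by
        rw [Real.exp_add, h4]
        field_simp
        norm_num

/-- There are lattices of covolume `O(n⁻²)` volumes of the unit ball, all of whose nonzero vectors
have length at least one. -/
lemma exists_det_le {n : ℕ} (hn : 2 ≤ n) :
    ∃ W : Matrix (Fin n) (Fin n) ℝ, W.det ≠ 0 ∧
      |W.det| * (n : ℝ) ^ 2 ≤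
        8 * Real.exp ((8 * Real.exp 3 + 1) / 2) * volume.real (unitBall n) ∧
      ∀ m : Fin n → ℤ, m ≠ 0 → 1 ≤ (W *ᵥ fun i => (m i : ℝ)) ⬝ᵥ (W *ᵥ fun i => (m i : ℝ)) := by
  have hn' : (2 : ℝ) ≤ n := by exact_mod_cast hn
  have hn0 : (0 : ℝ) < n := by linarith
  set C₀ := 8 * Real.exp 3
  set T := 16 * Real.log n / (n * (n + 1)) with hT
  have hT0 : 0 ≤ T := div_nonneg (mul_nonneg (by norm_num) (Real.log_nonneg (by linarith)))
    (by positivity)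
  have hτ₀ : 0 < 1 / (n : ℝ) ^ 2 := by positivity
  obtain ⟨R, hR⟩ := exists_posDef_log_det_le (n := n) (by omega) C₀ hT0 hτ₀
  obtain ⟨k, rfl⟩ : ∃ k, n = k + 1 := ⟨n - 1, by omega⟩
  obtain ⟨M, hMdet, hM1, X, hX, hsum⟩ := exists_lattice_sum_barrier_le (k := k) (by omega)
    (add_pos_of_nonneg_of_pos hT0 hτ₀) R
  obtain ⟨A, hA, hA1, hAdet⟩ := hR _ X hX (by
    rintro _ ⟨m, hm, rfl⟩
    exact hM1 m hm) (hsum.trans (barrier_constant_le hn))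
  obtain ⟨B, hB, rfl⟩ := exists_eq_transpose_mul_self hA
  have hω := volume_unitBall_pos (k + 1)
  refine ⟨B * M, ?_, ?_, fun m hm => ?_⟩
  · rw [det_mul, hMdet]
    positivity
  · have h1 : Real.log |B.det| ≤ (C₀ + 1) / 2 - 2 * Real.log (k + 1 : ℕ) := by
      rw [det_mul, det_transpose, ← abs_mul_abs_self, Real.log_mul (abs_pos.2 hB).ne'
        (abs_pos.2 hB).ne', hT] at hAdet
      have : ((k + 1 : ℕ) : ℝ) * ((k + 1 : ℕ) + 1) / 4 *
          (16 * Real.log (k + 1 : ℕ) / ((k + 1 : ℕ) * ((k + 1 : ℕ) + 1))) =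
          4 * Real.log (k + 1 : ℕ) := by
        field_simp
        norm_num
      linarith
    have h2 : |B.det| * ((k + 1 : ℕ) : ℝ) ^ 2 ≤ Real.exp ((C₀ + 1) / 2) := by
      rw [← Real.log_le_iff_le_exp (by positivity), Real.log_mul (abs_pos.2 hB).ne' (by positivity),
        Real.log_pow]
      push_cast at h1 ⊢
      linarith
    rw [det_mul, abs_mul, hMdet, abs_of_pos (a := 8 * volume.real (unitBall (k + 1))) (by positivity)]
    calc _ = 8 * (|B.det| * ((k + 1 : ℕ) : ℝ) ^ 2) * volume.real (unitBall (k + 1)) := by ring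
      _ ≤ _ := by gcongr
  · rw [← mulVec_mulVec]
    have := hA1 _ ⟨m, hm, rfl⟩
    rwa [← mul_one Bᵀ, quad_transpose_mul_mul, quad_one] at this

theorem exists_covolume_one_lattice_avoiding_ball :
    ∃ c : ℝ, 0 < c ∧ ∀ n : ℕ, 2 ≤ n → ∀ r : ℝ, 0 < r →
      volume (Metric.ball (0 : Euc n) r) = ENNReal.ofReal (c * (n : ℝ) ^ 2) →
      ∃ T : Euc n ≃ₗ[ℝ] Euc n,
        |LinearMap.det (T : Euc n →ₗ[ℝ] Euc n)| = 1 ∧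
        (T '' intPoints n) ∩ Metric.ball (0 : Euc n) r = {0} := by
  set D := 8 * Real.exp ((8 * Real.exp 3 + 1) / 2) with hD
  have hD0 : 0 < D := by positivity
  refine ⟨1 / D, by positivity, fun n hn r hr hvol => ?_⟩
  obtain ⟨W, hW0, hWdet, hW1⟩ := exists_det_le hn
  set ω := volume.real (unitBall n) with hω
  have hW0' : 0 < |W.det| := abs_pos.2 hW0
  have hvol' : r ^ n * ω = 1 / D * (n : ℝ) ^ 2 := by
    have : Nonempty (Fin n) := ⟨⟨0, by omega⟩⟩
    have : Nontrivial (Euc n) := inferInstance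
    rw [Measure.addHaar_ball volume _ hr.le, ← Measure.addHaar_closedBall_eq_addHaar_ball,
      ← volume_unitBall, finrank_euclideanSpace_fin] at hvol
    have := congrArg ENNReal.toReal hvol
    rwa [ENNReal.toReal_mul, ENNReal.toReal_ofReal (by positivity),
      ENNReal.toReal_ofReal (by positivity)] at this
  obtain ⟨μ, hμ0, hμ⟩ : ∃ μ : ℝ, 0 < μ ∧ μ ^ n = |W.det|⁻¹ :=
    ⟨|W.det|⁻¹ ^ ((n : ℝ)⁻¹), by positivity, Real.rpow_inv_natCast_pow (by positivity) (by omega)⟩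
  have hrμ : r ≤ μ := by
    have hω0 : 0 < ω := volume_unitBall_pos n
    refine le_of_pow_le_pow_left₀ (n := n) (by omega) hμ0.le ?_
    rw [hμ, le_inv_comm₀ (by positivity) hW0']
    have h1 : |W.det| * (n : ℝ) ^ 2 * r ^ n ≤ (n : ℝ) ^ 2 := by
      calc |W.det| * (n : ℝ) ^ 2 * r ^ n ≤ D * ω * r ^ n := by gcongr
        _ = D * (r ^ n * ω) := by ring
        _ = (n : ℝ) ^ 2 := by
            rw [hvol']
            field_simp
    have hn0 : (0 : ℝ) < (n : ℝ) ^ 2 := by positivity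
    rw [← one_div, le_div_iff₀ (by positivity)]
    nlinarith
  let L : Euc n →ₗ[ℝ] Euc n := Matrix.toLpLin 2 2 (μ • W)
  have hLdet : LinearMap.det L = μ ^ n * W.det := by
    simp only [L]
    rw [Matrix.toLpLin_eq_toLin, LinearMap.det_toLin, det_smul, Fintype.card_fin]
  have hL0 : LinearMap.det L ≠ 0 := by
    rw [hLdet]
    positivity
  refine ⟨L.equivOfDetNeZero hL0, ?_, ?_⟩
  · change |LinearMap.det L| = 1
    rw [hLdet, abs_mul, abs_of_pos (by positivity : 0 < μ ^ n), hμ, inv_mul_cancel₀ hW0'.ne']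
  · ext y
    simp only [Set.mem_inter_iff, Set.mem_image, mem_ball_zero_iff, Set.mem_singleton_iff]
    constructor
    · rintro ⟨⟨x, hx, rfl⟩, hy⟩
      choose m hm using hx
      have hmx : (fun i => (m i : ℝ)) = WithLp.ofLp x := funext fun i => (hm i).symm
      by_contra hne
      have hm0 : m ≠ 0 := by
        rintro rfl
        refine hne ?_
        have : x = 0 := by
          ext i
          simp [hm i]
        rw [this, map_zero]
      have h1 := hW1 m hm0
      have h2 : ‖L x‖ ^ 2 = μ ^ 2 * ((W *ᵥ fun i => (m i : ℝ)) ⬝ᵥ (W *ᵥ fun i => (m i : ℝ))) := by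
        rw [EuclideanSpace.norm_sq_eq, hmx]
        simp only [L, Matrix.toLpLin_apply, dotProduct, Finset.mul_sum, smul_mulVec, Pi.smul_apply,
          smul_eq_mul, Real.norm_eq_abs, sq_abs]
        exact Finset.sum_congr rfl fun i _ => by ring
      change ‖L x‖ < r at hy
      have h3 : ‖L x‖ ^ 2 < μ ^ 2 := pow_lt_pow_left₀ (hy.trans_le hrμ) (norm_nonneg _) two_ne_zero
      nlinarith [sq_nonneg μ]
    · rintro rfl
      exact ⟨⟨0, fun i => ⟨0, by simp⟩, map_zero _⟩, by simpa using hr⟩
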